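/- arXiv:math/0104053 — 3 statements merged into one kernel-verified Lean document; each statement's English description precedes it below -/
import Mathlib

section
/- For all integers ν ≥ 1, 0 ≤ s ≤ ν, L ≥ 0, and every tuple n = (n_1,…,n_ν) of nonnegative integers, the following polynomial identity in q holds: q^{N_1²+⋯+N_ν²+N_{s+1}+⋯+N_ν} ∏_{i=1}^ν [n_i + L − 2Σ_{l=1}^i N_l − α_{i,s} choose n_i]_q = Σ_{p ∈ P^ν_{0,L}(ν−s,0,n)} q^{w(p)}. -/
open scoped Classical

noncomputable section

/-- The q-Pochhammer symbol `(q)_n = ∏_{j=1}^n (1 - q^j)`. -/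
def qP {F : Type*} [Field F] (q : F) (n : ℕ) : F :=
  ∏ j ∈ Finset.range n, (1 - q ^ (j + 1))

/-- The q-binomial coefficient `[N choose k]_q = (q)_N / ((q)_k (q)_{N-k})`
for `0 ≤ k ≤ N`, and `0` otherwise. -/
def qB {F : Type*} [Field F] (q : F) (N k : ℤ) : F :=
  if 0 ≤ k ∧ k ≤ N then qP q N.toNat / (qP q k.toNat * qP q (N - k).toNat) else 0

/-- `NN n i = N_i = n_i + n_{i+1} + ⋯ + n_ν` (indices 1-based; `n ⟨k⟩` is `n_{k+1}`). -/
def NN {ν : ℕ} (n : Fin ν → ℕ) (i : ℕ) : ℕ :=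
  ∑ k : Fin ν, if i ≤ (k : ℕ) + 1 then n k else 0

/-- `α_{i,s} = max(0, i - s)`. -/
def alph (i s : ℕ) : ℤ := max 0 ((i : ℤ) - s)

/-- The exponent `N_1² + ⋯ + N_ν² + N_{s+1} + ⋯ + N_ν`. -/
def expAG (ν s : ℕ) (nn : Fin ν → ℕ) : ℕ :=
  (∑ i ∈ Finset.Icc 1 ν, (NN nn i) ^ 2) + ∑ i ∈ Finset.Icc (s + 1) ν, NN nn i

/-- The polynomial `B^ν_{s,b}(L,q)` of Foda–Quano–Kirillov type. -/
def B {F : Type*} [Field F] (ν : ℕ) (s b : ℤ) (L : ℕ) (q : F) : F :=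
  ∑ᶠ j : ℤ,
    (q ^ (j * ((2 * j + 1) * (2 * (ν : ℤ) + 3) - 2 * s)) *
        qB q (L : ℤ) (((L : ℤ) + b - s) / 2 + j * (2 * (ν : ℤ) + 3)) -
      q ^ ((2 * j + 1) * ((2 * (ν : ℤ) + 3) * j + s)) *
        qB q (L : ℤ) (((L : ℤ) + b + s) / 2 + j * (2 * (ν : ℤ) + 3)))

/-- `jjf j l = j_l` for `1 ≤ l ≤ ν` (and junk value `0` otherwise). -/
def jjf {ν : ℕ} (j : Fin ν → ℕ) (l : ℕ) : ℤ :=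
  if h : l - 1 < ν then (j ⟨l - 1, h⟩ : ℤ) else 0

/-- The q-multinomial coefficient `[L choose a]^(p)_ν`. -/
def qMulti {F : Type*} [Field F] (ν L : ℕ) (a : ℤ) (p : ℕ) (q : F) : F :=
  ∑ᶠ j : Fin ν → ℕ,
    if (∑ l, (j l : ℤ)) = a then
      q ^ ((∑ l ∈ Finset.Icc 2 ν, jjf j (l - 1) * ((L : ℤ) - jjf j l)) -
            ∑ l ∈ Finset.Icc 1 p, jjf j l) *
        qB q (L : ℤ) (jjf j ν) * ∏ l ∈ Finset.Icc 2 ν, qB q (jjf j l) (jjf j (l - 1))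
    else 0

/-- The polynomial `W^ν_{s,b}(L,q)` of Warnaar type. -/
def W {F : Type*} [Field F] (ν : ℕ) (s : ℤ) (b L : ℕ) (q : F) : F :=
  ∑ᶠ j : ℤ,
    (q ^ (j * ((2 * j + 1) * (2 * (ν : ℤ) + 3) - 2 * s)) *
        qMulti ν L (((ν : ℤ) * ((L : ℤ) + 1) - s - b + 1) / 2 + (2 * (ν : ℤ) + 3) * j) b q -
      q ^ ((2 * j + 1) * ((2 * (ν : ℤ) + 3) * j + s)) *
        qMulti ν L (((ν : ℤ) * ((L : ℤ) + 1) + s - b + 1) / 2 + (2 * (ν : ℤ) + 3) * j) b q)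

/-! ### Bressoud lattice paths -/

/-- Step values: `0 ↦ NE (+1)`, `1 ↦ SE (−1)`, `2 ↦ horizontal (0)`. -/
def stepVal : Fin 3 → ℤ := ![1, -1, 0]

/-- Height of the path after `k` steps, starting at height `s`. -/
def hts (s : ℤ) {n : ℕ} (d : Fin n → Fin 3) (k : ℕ) : ℤ :=
  s + ∑ i ∈ Finset.range k, if h : i < n then stepVal (d ⟨i, h⟩) else 0

/-- The vertex `k` is a peak: it is preceded by a NE step and followed by a SE step. -/
def IsPeak {n : ℕ} (d : Fin n → Fin 3) (k : ℕ) : Prop :=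
  ∃ hk : k < n, 1 ≤ k ∧ d ⟨k - 1, Nat.lt_of_le_of_lt (Nat.sub_le k 1) hk⟩ = 0 ∧ d ⟨k, hk⟩ = 1

/-- `d` encodes a Bressoud path from height `s` to height `b` whose peaks have height `≤ ν`:
SE steps only from positive height, horizontal steps only on the x-axis. -/
def ValidPath (ν : ℕ) (s b : ℤ) {n : ℕ} (d : Fin n → Fin 3) : Prop :=
  hts s d n = b ∧
    (∀ k : Fin n, (d k = 1 → 0 < hts s d (k : ℕ)) ∧ (d k = 2 → hts s d (k : ℕ) = 0)) ∧
    (∀ k : ℕ, IsPeak d k → hts s d k ≤ (ν : ℤ))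

/-- The weight of a Bressoud path starting at x-coordinate `M`:
the sum of the x-coordinates of its peaks. -/
def pwt (M : ℤ) {n : ℕ} (d : Fin n → Fin 3) : ℤ :=
  ∑ k ∈ Finset.range (n + 1), if IsPeak d k then M + (k : ℤ) else 0

/-- `C^ν_{M,L}(s,b,q)`: the weighted count of Bressoud paths from `(M,s)` to `(L,b)`
with no peak higher than `ν`. -/
def Cpoly {F : Type*} [Field F] (ν : ℕ) (M L : ℤ) (s b : ℕ) (q : F) : F :=
  ∑ d ∈ Finset.univ.filter (fun d : Fin (L - M).toNat → Fin 3 => ValidPath ν (s : ℤ) (b : ℤ) d),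
    q ^ pwt M d

/-- `t` is an admissible relative height for the peak at vertex `k`. -/
def RelProp (s : ℤ) {n : ℕ} (d : Fin n → Fin 3) (k t : ℕ) : Prop :=
  0 < t ∧ ∃ k' k'' : ℕ, k' < k ∧ k < k'' ∧ k'' ≤ n ∧
    hts s d k' = hts s d k - t ∧ hts s d k'' = hts s d k - t ∧
    ∀ m : ℕ, k' < m → m < k'' → IsPeak d m →
      hts s d m ≤ hts s d k ∧ (hts s d m = hts s d k → k ≤ m)

/-- The relative height of the peak at vertex `k`: the largest `t` with `RelProp`. -/
def relHt (ν : ℕ) (s : ℤ) {n : ℕ} (d : Fin n → Fin 3) (k : ℕ) : ℕ :=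
  Nat.findGreatest (RelProp s d k) (ν + n)

/-- `P^ν_{M,L}(s,b,n)`: Bressoud paths from `(M,s)` to `(L,b)`, peaks of height at most `ν`,
with exactly `nn j` peaks of relative height `j+1`. -/
def Pset (ν : ℕ) (M L : ℤ) (s b : ℤ) (nn : Fin ν → ℕ) : Finset (Fin (L - M).toNat → Fin 3) :=
  Finset.univ.filter (fun d => ValidPath ν s b d ∧
    ∀ j : Fin ν, ((Finset.range ((L - M).toNat + 1)).filter
      (fun k => IsPeak d k ∧ relHt ν s d k = (j : ℕ) + 1)).card = nn j)

/-! ### Gordon lattice paths -/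

/-- `f` encodes a Gordon path of length `n` from height `s` to height `b`:
`f 0 = s`, `f n = b`, adjacent frequencies sum to at most `ν`; values beyond `n` are `0`. -/
def IsGordon (ν n s b : ℕ) (f : ℕ → ℕ) : Prop :=
  f 0 = s ∧ f n = b ∧ (∀ k, k < n → f k + f (k + 1) ≤ ν) ∧ (∀ k, n < k → f k = 0)

/-- The weight `Σ_{j=M+1}^{L-1} j f_j` of a Gordon path starting at x-coordinate `M`. -/
def gwt (M : ℤ) (n : ℕ) (f : ℕ → ℕ) : ℤ :=
  ∑ k ∈ Finset.Ioo 0 n, (M + (k : ℤ)) * (f k : ℤ)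

/-- `G^ν_{M,L}(s,b,q)`: the weighted count of Gordon paths from `(M,s)` to `(L,b)`. -/
def G {F : Type*} [Field F] (ν : ℕ) (M L : ℤ) (s b : ℕ) (q : F) : F :=
  ∑ᶠ f : ℕ → ℕ, if IsGordon ν (L - M).toNat s b f then q ^ gwt M (L - M).toNat f else 0

/-- `F^ν_{s,b}(L,q)` of (2.21). -/
def Fpoly {F : Type*} [Field F] (ν s b L : ℕ) (q : F) : F :=
  ∑ᶠ nn : Fin ν → ℕ, q ^ expAG ν s nn *
    ∏ i : Fin ν, qB q ((nn i : ℤ) + ((i : ℕ) + 1) * (L : ℤ) -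
      2 * (∑ l ∈ Finset.Icc 1 ((i : ℕ) + 1), (NN nn l : ℤ)) -
      alph ((i : ℕ) + 1) s - alph ((i : ℕ) + 1) b) (nn i)

/-- The left-hand side of (4.2): `F` with the extra `−M(N_1+⋯+N_ν)` in the exponent. -/
def FpolyM {F : Type*} [Field F] (ν s b L M : ℕ) (q : F) : F :=
  ∑ᶠ nn : Fin ν → ℕ,
    q ^ ((expAG ν s nn : ℤ) - (M : ℤ) * ∑ i ∈ Finset.Icc 1 ν, (NN nn i : ℤ)) *
    ∏ i : Fin ν, qB q ((nn i : ℤ) + ((i : ℕ) + 1) * (L : ℤ) -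
      2 * (∑ l ∈ Finset.Icc 1 ((i : ℕ) + 1), (NN nn l : ℤ)) -
      alph ((i : ℕ) + 1) s - alph ((i : ℕ) + 1) b) (nn i)


abbrev K : Type := RatFunc ℚ


namespace BP

/-- extension by horizontal steps -/
def ext {n : ℕ} (d : Fin n → Fin 3) (i : ℕ) : Fin 3 := if h : i < n then d ⟨i, h⟩ else 2

def H (s : ℤ) (f : ℕ → Fin 3) (k : ℕ) : ℤ := s + ∑ i ∈ Finset.range k, stepVal (f i)

def PK (f : ℕ → Fin 3) (k : ℕ) : Prop := 1 ≤ k ∧ f (k - 1) = 0 ∧ f k = 1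

def Val (ν : ℕ) (s b : ℤ) (f : ℕ → Fin 3) (n : ℕ) : Prop :=
  H s f n = b ∧ (∀ k < n, (f k = 1 → 0 < H s f k) ∧ (f k = 2 → H s f k = 0)) ∧
    ∀ k, PK f k → H s f k ≤ (ν : ℤ)

def RP (s : ℤ) (f : ℕ → Fin 3) (n k t : ℕ) : Prop :=
  0 < t ∧ ∃ k' k'' : ℕ, k' < k ∧ k < k'' ∧ k'' ≤ n ∧
    H s f k' = H s f k - t ∧ H s f k'' = H s f k - t ∧
    ∀ m : ℕ, k' < m → m < k'' → PK f m → H s f m ≤ H s f k ∧ (H s f m = H s f k → k ≤ m)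

def MR (s : ℤ) (f : ℕ → Fin 3) (n k r : ℕ) : Prop :=
  RP s f n k r ∧ ∀ t, RP s f n k t → t ≤ r

def wt (f : ℕ → Fin 3) (n : ℕ) : ℕ := ∑ k ∈ Finset.range (n + 1), if PK f k then k else 0

def cnt (s : ℤ) (f : ℕ → Fin 3) (n r : ℕ) : ℕ :=
  ∑ k ∈ Finset.range (n + 1), if PK f k then (if MR s f n k r then 1 else 0) else 0

def Good (ν : ℕ) (y : ℤ) (f : ℕ → Fin 3) (n : ℕ) (nn : Fin ν → ℕ) : Prop :=
  Val ν y 0 f n ∧ ∀ j : Fin ν, cnt y f n ((j : ℕ) + 1) = nn j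

def S (ν : ℕ) (y : ℤ) (L : ℕ) (nn : Fin ν → ℕ) : K :=
  ∑ d ∈ Finset.univ.filter (fun d : Fin L → Fin 3 => Good ν y (ext d) L nn),
    (RatFunc.X : K) ^ wt (ext d) L

lemma ext_ge {n : ℕ} (d : Fin n → Fin 3) {i : ℕ} (h : n ≤ i) : ext d i = 2 := by
  simp [ext, Nat.not_lt.mpr h]

lemma ext_lt {n : ℕ} (d : Fin n → Fin 3) {i : ℕ} (h : i < n) : ext d i = d ⟨i, h⟩ := by
  simp [ext, h]

lemma hts_eq (s : ℤ) {n : ℕ} (d : Fin n → Fin 3) (k : ℕ) : hts s d k = H s (ext d) k := by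
  unfold hts H
  congr 1
  apply Finset.sum_congr rfl
  intro i _
  unfold ext
  split_ifs <;> simp [stepVal]

lemma isPeak_iff {n : ℕ} (d : Fin n → Fin 3) (k : ℕ) : IsPeak d k ↔ PK (ext d) k := by
  unfold IsPeak PK
  constructor
  · rintro ⟨hk, h1, h2, h3⟩
    refine ⟨h1, ?_, ?_⟩
    · rw [ext_lt d (by omega)]; exact h2
    · rw [ext_lt d hk]; exact h3
  · rintro ⟨h1, h2, h3⟩
    have hk : k < n := by
      by_contra hk
      rw [ext_ge d (by omega)] at h3
      exact absurd h3 (by decide)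
    refine ⟨hk, h1, ?_, ?_⟩
    · rw [ext_lt d (by omega)] at h2; exact h2
    · rw [ext_lt d hk] at h3; exact h3

lemma relProp_iff (s : ℤ) {n : ℕ} (d : Fin n → Fin 3) (k t : ℕ) :
    RelProp s d k t ↔ RP s (ext d) n k t := by
  unfold RelProp RP
  simp only [hts_eq, isPeak_iff]

lemma stepVal_0 : stepVal 0 = 1 := rfl
lemma stepVal_1 : stepVal 1 = -1 := rfl
lemma stepVal_2 : stepVal 2 = 0 := rfl

lemma H_zero (s : ℤ) (f : ℕ → Fin 3) : H s f 0 = s := by simp [H]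

lemma H_succ (s : ℤ) (f : ℕ → Fin 3) (k : ℕ) : H s f (k + 1) = H s f k + stepVal (f k) := by
  simp [H, Finset.sum_range_succ, add_assoc]

lemma fin3 (a : Fin 3) : a = 0 ∨ a = 1 ∨ a = 2 := by
  fin_cases a <;> simp

lemma H_step (s : ℤ) (f : ℕ → Fin 3) (k : ℕ) :
    H s f (k + 1) ≤ H s f k + 1 ∧ H s f k - 1 ≤ H s f (k + 1) := by
  rw [H_succ]
  rcases fin3 (f k) with h | h | h <;> rw [h] <;>
    simp only [stepVal_0, stepVal_1, stepVal_2] <;> constructor <;> linarith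

lemma H_diff (s : ℤ) (f : ℕ → Fin 3) (a k : ℕ) (h : a ≤ k) : H s f k ≤ H s f a + (k - a : ℤ) := by
  induction k, h using Nat.le_induction with
  | base => simp
  | succ k hk ih => have := (H_step s f k).1; push_cast; linarith

lemma RP_le {s : ℤ} {f : ℕ → Fin 3} {n k t : ℕ} (h : RP s f n k t) : t ≤ n := by
  obtain ⟨_, k', k'', h1, h2, h3, h4, _⟩ := h
  have := H_diff s f k' k h1.le
  omega

lemma PK_prev {s : ℤ} {f : ℕ → Fin 3} {k : ℕ} (h : PK f k) :
    H s f (k - 1) = H s f k - 1 ∧ H s f (k + 1) = H s f k - 1 := by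
  obtain ⟨h1, h2, h3⟩ := h
  have a := H_succ s f (k - 1)
  have b := H_succ s f k
  rw [Nat.sub_add_cancel h1, h2, stepVal_0] at a
  rw [h3, stepVal_1] at b
  constructor <;> linarith

lemma PK_RP1 {s : ℤ} {f : ℕ → Fin 3} {n k : ℕ} (h : PK f k) (hk : k < n) : RP s f n k 1 := by
  have := PK_prev (s := s) h
  refine ⟨one_pos, k - 1, k + 1, ?_, by omega, by omega, by simpa using this.1, by simpa using this.2, ?_⟩
  · have := h.1; omega
  · intro m h1 h2 _
    have : m = k := by omega
    subst this; simp

lemma exists_MR {s : ℤ} {f : ℕ → Fin 3} {n k : ℕ} (h : PK f k) (hk : k < n) :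
    ∃ r, 1 ≤ r ∧ MR s f n k r := by
  have h1 := PK_RP1 (s := s) h hk
  refine ⟨Nat.findGreatest (RP s f n k) n, ?_, ?_, ?_⟩
  · exact Nat.le_findGreatest (RP_le h1) h1
  · exact Nat.findGreatest_spec (RP_le h1) h1
  · intro t ht
    exact Nat.le_findGreatest (RP_le ht) ht

lemma MR_unique {s : ℤ} {f : ℕ → Fin 3} {n k r r' : ℕ} (h : MR s f n k r) (h' : MR s f n k r') :
    r = r' := le_antisymm (h'.2 _ h.1) (h.2 _ h'.1)

lemma relHt_iff (ν : ℕ) (s : ℤ) {n : ℕ} (d : Fin n → Fin 3) (k r : ℕ) (hr : 1 ≤ r) :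
    relHt ν s d k = r ↔ MR s (ext d) n k r := by
  unfold relHt
  rw [Nat.findGreatest_eq_iff]
  simp only [relProp_iff]
  constructor
  · rintro ⟨h1, h2, h3⟩
    refine ⟨h2 (by omega), ?_⟩
    intro t ht
    by_contra hlt
    exact h3 (n := t) (by omega) (by have := RP_le ht; omega) ht
  · rintro ⟨h1, h2⟩
    refine ⟨by have := RP_le h1; omega, fun _ => h1, ?_⟩
    intro t ht _ h
    have := h2 t h
    omega

lemma pset_iff (ν : ℕ) (y : ℤ) {n : ℕ} (nn : Fin ν → ℕ) (d : Fin n → Fin 3) :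
    (ValidPath ν y 0 d ∧ ∀ j : Fin ν, ((Finset.range (n + 1)).filter
      (fun k => IsPeak d k ∧ relHt ν y d k = (j : ℕ) + 1)).card = nn j) ↔
    Good ν y (ext d) n nn := by
  unfold Good ValidPath Val
  apply and_congr
  · simp only [hts_eq, isPeak_iff]
    refine and_congr Iff.rfl (and_congr ?_ Iff.rfl)
    constructor
    · intro h k hk
      have := h ⟨k, hk⟩
      rw [ext_lt d hk]; exact this
    · intro h k
      have := h k k.2
      rw [ext_lt d k.2] at this; exact this
  · refine forall_congr' fun j => ?_
    rw [Finset.card_filter]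
    unfold cnt
    have : ∀ k ∈ Finset.range (n+1), (if IsPeak d k ∧ relHt ν y d k = (j : ℕ) + 1 then 1 else 0) =
      if PK (ext d) k then (if MR y (ext d) n k ((j : ℕ) + 1) then 1 else 0) else 0 := by
      intro k _
      have e1 := isPeak_iff d k
      have e2 := relHt_iff ν y d k ((j : ℕ) + 1) (by omega)
      by_cases h1 : PK (ext d) k <;> by_cases h2 : MR y (ext d) n k ((j : ℕ) + 1) <;>
        simp [e1, e2, h1, h2]
    rw [Finset.sum_congr rfl this]

lemma pwt_eq {n : ℕ} (d : Fin n → Fin 3) : pwt 0 d = (wt (ext d) n : ℤ) := by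
  unfold pwt wt
  push_cast
  apply Finset.sum_congr rfl
  intro k _
  rw [isPeak_iff]; simp

lemma sum_eq (ν : ℕ) (y : ℤ) (L : ℕ) (nn : Fin ν → ℕ) :
    ∑ d ∈ Pset ν 0 (L : ℤ) y 0 nn, (RatFunc.X : K) ^ pwt 0 d = S ν y L nn := by
  unfold Pset S
  have hL : ((L : ℤ) - 0).toNat = L := by simp
  generalize ((L : ℤ) - 0).toNat = M at hL
  subst hL
  simp only [pset_iff, pwt_eq, zpow_natCast]

/-! maxima -/

lemma H_nonneg {ν : ℕ} {s b : ℤ} {f : ℕ → Fin 3} {n : ℕ} (hs : 0 ≤ s) (hv : Val ν s b f n)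
    (k : ℕ) (hk : k ≤ n) : 0 ≤ H s f k := by
  induction k with
  | zero => simpa [H_zero]
  | succ k ih =>
    have h0 := ih (by omega)
    have := hv.2.1 k (by omega)
    rw [H_succ]
    rcases fin3 (f k) with h | h | h
    · rw [h, stepVal_0]; omega
    · rw [h, stepVal_1]; have := this.1 h; omega
    · rw [h, stepVal_2]; omega

lemma max_peak {ν : ℕ} {s b : ℤ} {f : ℕ → Fin 3} {n : ℕ} (hs : 0 ≤ s) (hv : Val ν s b f n)
    {a v c : ℕ} (h1 : a < v) (h2 : v < c) (hc : c ≤ n) (ha : H s f a < H s f v)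
    (hcv : H s f c < H s f v) :
    ∃ u, a < u ∧ u < c ∧ PK f u ∧ (∀ w, a ≤ w → w ≤ c → H s f w ≤ H s f u) ∧
      (∀ w, a ≤ w → w ≤ c → H s f w = H s f u → PK f w) := by
  obtain ⟨u, hu, hmax⟩ := Finset.exists_max_image (Finset.Icc a c) (H s f) ⟨v, by simp; omega⟩
  simp only [Finset.mem_Icc] at hu hmax
  have huv := hmax v ⟨h1.le, h2.le⟩
  have key : ∀ w, a ≤ w → w ≤ c → H s f w = H s f u → PK f w := by
    intro w hw1 hw2 hw
    have hwa : w ≠ a := by rintro rfl; omega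
    have hwc : w ≠ c := by rintro rfl; omega
    have hpos : 0 < H s f w := by
      have := H_nonneg hs hv a (by omega); omega
    refine ⟨by omega, ?_, ?_⟩
    · have e := H_succ s f (w - 1)
      rw [Nat.sub_add_cancel (by omega)] at e
      have m := hmax (w - 1) ⟨by omega, by omega⟩
      have vv := hv.2.1 (w - 1) (by omega)
      rcases fin3 (f (w - 1)) with h | h | h
      · exact h
      · rw [h, stepVal_1] at e; omega
      · have := vv.2 h; rw [h, stepVal_2] at e; omega
    · have e := H_succ s f w
      have m := hmax (w + 1) ⟨by omega, by omega⟩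
      have vv := hv.2.1 w (by omega)
      rcases fin3 (f w) with h | h | h
      · rw [h, stepVal_0] at e; omega
      · exact h
      · have := vv.2 h; omega
  refine ⟨u, ?_, ?_, key u hu.1 hu.2 rfl, fun w a b => hmax w ⟨a, b⟩, key⟩
  · rcases hu.1.lt_or_eq with h | h
    · exact h
    · subst h; omega
  · rcases hu.2.lt_or_eq with h | h
    · exact h
    · subst h; omega

lemma H_le {ν : ℕ} {s : ℤ} {f : ℕ → Fin 3} {n : ℕ} (hs : 0 ≤ s) (hsν : s ≤ ν)
    (hv : Val ν s 0 f n) (k : ℕ) (hk : k ≤ n) : H s f k ≤ ν := by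
  by_contra hlt
  push Not at hlt
  have h0 : k ≠ 0 := by rintro rfl; rw [H_zero] at hlt; omega
  have hn : k ≠ n := by rintro rfl; rw [hv.1] at hlt; omega
  obtain ⟨u, _, _, hp, hm, _⟩ := max_peak hs hv (a := 0) (v := k) (c := n) (by omega) (by omega) le_rfl
    (by rw [H_zero]; omega) (by rw [hv.1]; omega)
  have := hv.2.2 u hp
  have := hm k (by omega) hk
  omega

/-- discrete IVT, left-to-right upward -/
lemma ivt_up (s : ℤ) (f : ℕ → Fin 3) (a c : ℕ) (h : ℤ) (hac : a ≤ c) (ha : H s f a ≤ h)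
    (hc : h < H s f c) : ∃ v, a ≤ v ∧ v < c ∧ H s f v = h := by
  induction c, hac using Nat.le_induction with
  | base => omega
  | succ c hk ih =>
    by_cases hh : h < H s f c
    · obtain ⟨v, h1, h2, h3⟩ := ih hh
      exact ⟨v, h1, by omega, h3⟩
    · have := (H_step s f c).1
      exact ⟨c, hk, by omega, by omega⟩

lemma ivt_down (s : ℤ) (f : ℕ → Fin 3) (a c : ℕ) (h : ℤ) (hac : a ≤ c) (ha : h < H s f a)
    (hc : H s f c ≤ h) : ∃ v, a < v ∧ v ≤ c ∧ H s f v = h := by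
  induction c, hac using Nat.le_induction with
  | base => omega
  | succ c hk ih =>
    by_cases hh : H s f c ≤ h
    · obtain ⟨v, h1, h2, h3⟩ := ih hh
      exact ⟨v, h1, by omega, h3⟩
    · have := (H_step s f c).2
      exact ⟨c + 1, by omega, le_rfl, by omega⟩

/-- number of peaks -/
def np (f : ℕ → Fin 3) (n : ℕ) : ℕ := ∑ k ∈ Finset.range (n + 1), if PK f k then 1 else 0

lemma np_eq {ν : ℕ} {y : ℤ} {f : ℕ → Fin 3} {n : ℕ} {nn : Fin ν → ℕ} (hy : 0 ≤ y)
    (hf : ∀ i, n ≤ i → f i = 2) (hg : Good ν y f n nn) : np f n = ∑ j, nn j := by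
  have : ∀ j, nn j = cnt y f n ((j : ℕ) + 1) := fun j => (hg.2 j).symm
  simp only [this]
  unfold np cnt
  rw [Finset.sum_comm]
  apply Finset.sum_congr rfl
  intro k _
  by_cases hp : PK f k
  · simp only [hp, if_true]
    have hk : k < n := by
      by_contra hk
      have := hp.2.2
      rw [hf k (by omega)] at this
      exact absurd this (by decide)
    obtain ⟨r, hr1, hr⟩ := exists_MR (s := y) hp hk
    have hrν : r ≤ ν := by
      obtain ⟨_, k', k'', h1, h2, h3, h4, _⟩ := hr.1
      have := H_nonneg hy hg.1 k' (by omega)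
      have := hg.1.2.2 k hp
      omega
    rw [Finset.sum_eq_single ⟨r - 1, by omega⟩]
    · simp [Nat.sub_add_cancel hr1, hr]
    · intro j _ hj
      rw [if_neg]
      intro h
      have := MR_unique hr h
      apply hj; ext; simp; omega
    · simp
  · simp [hp]

/-! insertion of small peaks -/

def phi (m : ℕ → ℕ) (v : ℕ) : ℕ := v + 2 * ∑ u ∈ Finset.range v, m u

structure Ins (x : ℕ → Fin 3) (V : ℕ) (m : ℕ → ℕ) (p : ℕ → Fin 3) (n : ℕ) : Prop where
  up : ∀ v ≤ V, ∀ j < m v, p (phi m v + 2 * j) = 0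
  dn : ∀ v ≤ V, ∀ j < m v, p (phi m v + 2 * j + 1) = 1
  st : ∀ v < V, p (phi m v + 2 * m v) = x v
  len : n = phi m V + 2 * m V
  xe : ∀ i, V ≤ i → x i = 2
  pe : ∀ i, n ≤ i → p i = 2
  pk : ∀ v, PK x v → 1 ≤ m v

lemma phi_zero (m : ℕ → ℕ) : phi m 0 = 0 := by simp [phi]

lemma phi_succ (m : ℕ → ℕ) (v : ℕ) : phi m (v + 1) = phi m v + 2 * m v + 1 := by
  simp [phi, Finset.sum_range_succ]; ring

lemma phi_lt (m : ℕ → ℕ) {v u : ℕ} (h : v < u) : phi m v + 2 * m v < phi m u := by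
  induction u, h using Nat.le_induction with
  | base => rw [phi_succ]; omega
  | succ u hu ih => rw [phi_succ]; omega

namespace Ins
variable {x : ℕ → Fin 3} {V : ℕ} {m : ℕ → ℕ} {p : ℕ → Fin 3} {n : ℕ}

lemma phi_le (I : Ins x V m p n) {v : ℕ} (h : v ≤ V) : phi m v + 2 * m v ≤ n := by
  rw [I.len]
  rcases h.lt_or_eq with h | h
  · have := phi_lt m h; omega
  · subst h; exact le_rfl

lemma loc (I : Ins x V m p n) (k : ℕ) (hk : k ≤ n) :
    (∃ v j, v ≤ V ∧ j ≤ m v ∧ k = phi m v + 2 * j) ∨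
    (∃ v j, v ≤ V ∧ j < m v ∧ k = phi m v + 2 * j + 1) := by
  induction k with
  | zero => exact Or.inl ⟨0, 0, by omega, by omega, by simp [phi_zero]⟩
  | succ k ih =>
    rcases ih (by omega) with ⟨v, j, h1, h2, h3⟩ | ⟨v, j, h1, h2, h3⟩
    · rcases h2.lt_or_eq with h | h
      · exact Or.inr ⟨v, j, h1, h, by omega⟩
      · rcases h1.lt_or_eq with h' | h'
        · exact Or.inl ⟨v + 1, 0, h', by omega, by rw [phi_succ, h3, h]⟩
        · have := I.len; subst h' h; omega
    · exact Or.inl ⟨v, j + 1, h1, h2, by omega⟩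

lemma H_base_aux (I : Ins x V m p n) (s : ℤ) {v : ℕ} (hv : v ≤ V)
    (h0 : H s p (phi m v) = H s x v) (j : ℕ) (hj : j ≤ m v) :
    H s p (phi m v + 2 * j) = H s x v := by
  induction j with
  | zero => simpa using h0
  | succ j ih =>
    have e : phi m v + 2 * (j + 1) = phi m v + 2 * j + 1 + 1 := by ring
    rw [e, H_succ, H_succ, I.up v hv j hj, I.dn v hv j hj, ih (by omega), stepVal_0, stepVal_1]
    ring

lemma H_phi (I : Ins x V m p n) (s : ℤ) {v : ℕ} (hv : v ≤ V) :
    H s p (phi m v) = H s x v := by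
  induction v with
  | zero => simp [phi_zero, H_zero]
  | succ v ih =>
    rw [phi_succ, H_succ, I.H_base_aux s (by omega) (ih (by omega)) _ le_rfl, I.st v hv, H_succ]

lemma H_base (I : Ins x V m p n) (s : ℤ) {v : ℕ} (hv : v ≤ V) {j : ℕ} (hj : j ≤ m v) :
    H s p (phi m v + 2 * j) = H s x v := I.H_base_aux s hv (I.H_phi s hv) j hj

lemma H_top (I : Ins x V m p n) (s : ℤ) {v : ℕ} (hv : v ≤ V) {j : ℕ} (hj : j < m v) :
    H s p (phi m v + 2 * j + 1) = H s x v + 1 := by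
  rw [H_succ, I.H_base s hv hj.le, I.up v hv j hj, stepVal_0]

lemma pk_top (I : Ins x V m p n) {v : ℕ} (hv : v ≤ V) {j : ℕ} (hj : j < m v) :
    PK p (phi m v + 2 * j + 1) :=
  ⟨by omega, by simpa using I.up v hv j hj, I.dn v hv j hj⟩

lemma pk_lt (I : Ins x V m p n) {k : ℕ} (h : PK p k) : k < n := by
  by_contra hk
  have := h.2.2
  rw [I.pe k (by omega)] at this
  exact absurd this (by decide)

lemma xpk_lt (I : Ins x V m p n) {k : ℕ} (h : PK x k) : k < V := by
  by_contra hk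
  have := h.2.2
  rw [I.xe k (by omega)] at this
  exact absurd this (by decide)

lemma pk_loc (I : Ins x V m p n) {k : ℕ} (h : PK p k) :
    ∃ v j, v ≤ V ∧ j < m v ∧ k = phi m v + 2 * j + 1 := by
  have hkn := I.pk_lt h
  rcases I.loc k hkn.le with ⟨v, j, h1, h2, h3⟩ | h'
  · exfalso
    obtain ⟨q1, q2, q3⟩ := h
    rcases h2.lt_or_eq with h2 | h2
    · rw [h3, I.up v h1 j h2] at q3
      exact absurd q3 (by decide)
    · have hvV : v < V := by
        rcases h1.lt_or_eq with h | h
        · exact h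
        · have := I.len; subst h h2; omega
      rw [h3, h2, I.st v hvV] at q3
      by_cases hj : j = 0
      · have hv0 : v ≠ 0 := by
          rintro rfl; rw [phi_zero] at h3; omega
        have hp : PK x v := by
          refine ⟨by omega, ?_, q3⟩
          have e := phi_succ m (v - 1)
          rw [Nat.sub_add_cancel (by omega)] at e
          rw [← I.st (v - 1) (by omega), ← q2]
          congr 1; omega
        have := I.pk v hp
        omega
      · have := I.dn v h1 (j - 1) (by omega)
        have e : phi m v + 2 * (j - 1) + 1 = k - 1 := by omega
        rw [e, q2] at this
        exact absurd this (by decide)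
  · exact h'

lemma inj_aux {v u j i : ℕ} (h : phi m v + 2 * j ≤ phi m u + 2 * i) (hi : i ≤ m u) : v ≤ u := by
  by_contra hlt
  have := phi_lt m (show u < v by omega)
  omega

lemma sum_peaks (I : Ins x V m p n) (g : ℕ → ℕ) :
    (∑ k ∈ Finset.range (n + 1), if PK p k then g k else 0) =
    ∑ v ∈ Finset.range (V + 1), ∑ j ∈ Finset.range (m v), g (phi m v + 2 * j + 1) := by
  rw [← Finset.sum_filter, Finset.sum_sigma']
  symm
  apply Finset.sum_nbij (fun a => phi m a.1 + 2 * a.2 + 1)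
  · rintro ⟨v, j⟩ h
    simp only [Finset.mem_sigma, Finset.mem_range, Finset.mem_filter] at h ⊢
    have := I.pk_top (v := v) (by omega) h.2
    exact ⟨by have := I.pk_lt this; omega, this⟩
  · rintro ⟨v, j⟩ h ⟨u, i⟩ h' e
    simp only [Finset.coe_sigma, Set.mem_sigma_iff, Finset.coe_range, Set.mem_Iio] at h h'
    simp only at e
    have h1 : v ≤ u := inj_aux (m := m) (j := j) (i := i) (by omega) (by omega)
    have h2 : u ≤ v := inj_aux (m := m) (j := i) (i := j) (by omega) (by omega)
    have : v = u := by omega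
    subst this
    have : j = i := by omega
    subst this; rfl
  · intro k hk
    simp only [Finset.coe_filter, Set.mem_ofPred_eq] at hk
    obtain ⟨v, j, h1, h2, h3⟩ := I.pk_loc hk.2
    refine ⟨⟨v, j⟩, ?_, h3.symm⟩
    simp only [Finset.coe_sigma, Set.mem_sigma_iff, Finset.coe_range, Set.mem_Iio]
    omega
  · intro a _; rfl

/-- The first inserted peak at a peak of `x`. -/
lemma RP_first (I : Ins x V m p n) {s : ℤ} (hs : 0 ≤ s) {ν : ℕ} {b : ℤ} (hx : Val ν s b x V)
    {v : ℕ} (hp : PK x v) {t : ℕ} (ht : 1 ≤ t) :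
    RP s p n (phi m v + 1) (t + 1) ↔ RP s x V v t := by
  have hvV := I.xpk_lt hp
  have hm := I.pk v hp
  have hH : H s p (phi m v + 1) = H s x v + 1 := I.H_top s hvV.le (j := 0) hm
  constructor
  · rintro ⟨_, k', k'', h1, h2, h3, h4, h5, h6⟩
    rw [hH] at h4 h5
    push_cast at h4 h5
    -- left
    have hl : ∃ v' , v' < v ∧ k' ≤ phi m v' + 2 * m v' ∧ H s x v' ≤ H s x v - t := by
      rcases I.loc k' (by omega) with ⟨u, j, g1, g2, g3⟩ | ⟨u, j, g1, g2, g3⟩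
      · have e := I.H_base s g1 g2
        rw [← g3, h4] at e
        have : u ≤ v := inj_aux (m := m) (j := j) (i := 0) (by omega) (by omega)
        refine ⟨u, ?_, by omega, by omega⟩
        rcases this.lt_or_eq with h | h
        · exact h
        · subst h; omega
      · have e := I.H_top s g1 g2
        rw [← g3, h4] at e
        have : u ≤ v := inj_aux (m := m) (j := j) (i := 0) (by omega) (by omega)
        refine ⟨u, ?_, by omega, by omega⟩
        rcases this.lt_or_eq with h | h
        · exact h
        · subst h; omega
    have hr : ∃ v'' , v < v'' ∧ v'' ≤ V ∧ phi m v'' ≤ k'' ∧ H s x v'' ≤ H s x v - t := by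
      rcases I.loc k'' (by omega) with ⟨u, j, g1, g2, g3⟩ | ⟨u, j, g1, g2, g3⟩
      · have e := I.H_base s g1 g2
        rw [← g3, h5] at e
        have : v ≤ u := inj_aux (m := m) (j := 0) (i := j) (by omega) (by omega)
        refine ⟨u, ?_, g1, by omega, by omega⟩
        rcases this.lt_or_eq with h | h
        · exact h
        · subst h; omega
      · have e := I.H_top s g1 g2
        rw [← g3, h5] at e
        have : v ≤ u := inj_aux (m := m) (j := 0) (i := j) (by omega) (by omega)
        refine ⟨u, ?_, g1, by omega, by omega⟩
        rcases this.lt_or_eq with h | h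
        · exact h
        · subst h; omega
    obtain ⟨v', l1, l2, l3⟩ := hl
    obtain ⟨v'', r1, r2, r3, r4⟩ := hr
    obtain ⟨a, a1, a2, a3⟩ := ivt_up s x v' v (H s x v - t) l1.le l3 (by omega)
    obtain ⟨c, c1, c2, c3⟩ := ivt_down s x v v'' (H s x v - t) r1.le (by omega) r4
    refine ⟨by omega, a, c, a2, c1, by omega, a3, c3, ?_⟩
    intro u u1 u2 hu
    have huV := I.xpk_lt hu
    have hmu := I.pk u hu
    have hHu : H s p (phi m u + 1) = H s x u + 1 := I.H_top s huV.le (j := 0) hmu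
    have q1 := phi_lt m (show v' < u by omega)
    have q2 := phi_lt m (show u < v'' by omega)
    have := h6 (phi m u + 1) (by omega) (by omega) (I.pk_top huV.le (j := 0) hmu)
    rw [hHu, hH] at this
    refine ⟨by omega, fun e => ?_⟩
    have := this.2 (by omega)
    exact inj_aux (m := m) (j := 0) (i := 0) (by omega) (by omega)
  · rintro ⟨_, a, c, h1, h2, h3, h4, h5, h6⟩
    have q1 := phi_lt m h1
    have q2 := phi_lt m h2
    refine ⟨by omega, phi m a + 2 * m a, phi m c, by omega, by omega, ?_, ?_, ?_, ?_⟩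
    · have := I.phi_le h3; omega
    · rw [I.H_base s (by omega) le_rfl, hH, h4]; push_cast; ring
    · rw [I.H_phi s h3, hH, h5]; push_cast; ring
    · intro k k1 k2 hk
      obtain ⟨u, j, g1, g2, g3⟩ := I.pk_loc hk
      have hau : a < u := by
        by_contra hlt
        rcases (show u ≤ a by omega).lt_or_eq with h | h
        · have := phi_lt m h; omega
        · subst h; omega
      have huc : u < c := by
        by_contra hlt
        rcases (show c ≤ u by omega).lt_or_eq with h | h
        · have := phi_lt m h; omega
        · subst h; omega
      obtain ⟨w, w1, w2, w3, w4, w5⟩ := max_peak hs hx h1 h2 h3 (by omega) (by omega)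
      have b1 := h6 w w1 w2 w3
      have b2 := w4 u hau.le huc.le
      have b3 := w4 v h1.le h2.le
      rw [g3, I.H_top s g1 g2, hH]
      refine ⟨by omega, fun e => ?_⟩
      have := h6 u hau huc (w5 u hau.le huc.le (by omega))
      have := this.2 (by omega)
      rcases this.lt_or_eq with h | h
      · have := phi_lt m h; omega
      · subst h; omega

/-- All other inserted peaks have relative height one. -/
lemma RP_other (I : Ins x V m p n) {s : ℤ} (hs : 0 ≤ s) {ν : ℕ} {b : ℤ} (hx : Val ν s b x V)
    {v j : ℕ} (hv : v ≤ V) (hj : j < m v) (ho : ¬ PK x v ∨ 1 ≤ j) {t : ℕ}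
    (h : RP s p n (phi m v + 2 * j + 1) t) : t ≤ 1 := by
  by_contra ht
  obtain ⟨_, k', k'', h1, h2, h3, h4, h5, h6⟩ := h
  have hH := I.H_top s hv hj
  rw [hH] at h4 h5 h6
  have hl : ∃ v' , v' < v ∧ k' ≤ phi m v' + 2 * m v' ∧ H s x v' < H s x v := by
    rcases I.loc k' (by omega) with ⟨u, i, g1, g2, g3⟩ | ⟨u, i, g1, g2, g3⟩
    · have e := I.H_base s g1 g2
      rw [← g3, h4] at e
      have : u ≤ v := inj_aux (m := m) (j := i) (i := j) (by omega) (by omega)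
      refine ⟨u, ?_, by omega, by omega⟩
      rcases this.lt_or_eq with h | h
      · exact h
      · subst h; omega
    · have e := I.H_top s g1 g2
      rw [← g3, h4] at e
      have : u ≤ v := inj_aux (m := m) (j := i) (i := j) (by omega) (by omega)
      refine ⟨u, ?_, by omega, by omega⟩
      rcases this.lt_or_eq with h | h
      · exact h
      · subst h; omega
  have hr : ∃ v'' , v < v'' ∧ v'' ≤ V ∧ phi m v'' ≤ k'' ∧ H s x v'' < H s x v := by
    rcases I.loc k'' (by omega) with ⟨u, i, g1, g2, g3⟩ | ⟨u, i, g1, g2, g3⟩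
    · have e := I.H_base s g1 g2
      rw [← g3, h5] at e
      have : v ≤ u := inj_aux (m := m) (j := j) (i := i) (by omega) (by omega)
      refine ⟨u, ?_, g1, by omega, by omega⟩
      rcases this.lt_or_eq with h | h
      · exact h
      · subst h; omega
    · have e := I.H_top s g1 g2
      rw [← g3, h5] at e
      have : v ≤ u := inj_aux (m := m) (j := j) (i := i) (by omega) (by omega)
      refine ⟨u, ?_, g1, by omega, by omega⟩
      rcases this.lt_or_eq with h | h
      · exact h
      · subst h; omega
  obtain ⟨v', l1, l2, l3⟩ := hl
  obtain ⟨v'', r1, r2, r3, r4⟩ := hr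
  have f1 := phi_lt m l1
  have f2 := phi_lt m r1
  by_cases hj1 : 1 ≤ j
  · have := h6 (phi m v + 2 * (j - 1) + 1) (by omega) (by omega) (I.pk_top hv (by omega))
    rw [I.H_top s hv (by omega)] at this
    have := this.2 rfl
    omega
  · have hnp : ¬ PK x v := by tauto
    obtain ⟨w, w1, w2, w3, w4, w5⟩ := max_peak hs hx l1 r1 r2 l3 r4
    have b := w4 v l1.le r1.le
    have q1 := phi_lt m w1
    have q2 := phi_lt m w2
    have hmw := I.pk w w3
    have := (h6 (phi m w + 2 * 0 + 1) (by omega) (by omega) (I.pk_top (by omega) hmw)).1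
    rw [I.H_top s (by omega) hmw] at this
    exact hnp (w5 v l1.le r1.le (by omega))

lemma MR_first (I : Ins x V m p n) {s : ℤ} (hs : 0 ≤ s) {ν : ℕ} {b : ℤ} (hx : Val ν s b x V)
    {v : ℕ} (hp : PK x v) {r : ℕ} :
    MR s p n (phi m v + 2 * 0 + 1) (r + 1) ↔ 1 ≤ r ∧ MR s x V v r := by
  have hvV := I.xpk_lt hp
  have hm := I.pk v hp
  obtain ⟨r0, hr0, hmr⟩ := exists_MR (s := s) hp hvV
  have hM : MR s p n (phi m v + 2 * 0 + 1) (r0 + 1) := by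
    refine ⟨(I.RP_first hs hx hp hr0).2 hmr.1, ?_⟩
    intro t ht
    by_cases h : t ≤ 1
    · omega
    · obtain ⟨t, rfl⟩ : ∃ t', t = t' + 1 := ⟨t - 1, by omega⟩
      have := hmr.2 t ((I.RP_first hs hx hp (by omega)).1 ht)
      omega
  constructor
  · intro h
    have := MR_unique h hM
    have : r = r0 := by omega
    subst this
    exact ⟨hr0, hmr⟩
  · rintro ⟨h1, h2⟩
    have := MR_unique h2 hmr
    subst this; exact hM

lemma MR_other (I : Ins x V m p n) {s : ℤ} (hs : 0 ≤ s) {ν : ℕ} {b : ℤ} (hx : Val ν s b x V)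
    {v j : ℕ} (hv : v ≤ V) (hj : j < m v) (ho : ¬ PK x v ∨ 1 ≤ j) {r : ℕ} :
    MR s p n (phi m v + 2 * j + 1) (r + 1) ↔ r = 0 := by
  have hp := I.pk_top hv hj
  have hM : MR s p n (phi m v + 2 * j + 1) 1 :=
    ⟨PK_RP1 hp (I.pk_lt hp), fun t ht => I.RP_other hs hx hv hj ho ht⟩
  constructor
  · intro h
    have := MR_unique h hM
    omega
  · rintro rfl; exact hM

lemma val_down (I : Ins x V m p n) {s b : ℤ} {ν : ℕ} (hp : Val (ν + 1) s b p n) :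
    Val ν s b x V := by
  obtain ⟨h1, h2, h3⟩ := hp
  refine ⟨?_, ?_, ?_⟩
  · rw [← h1, I.len, I.H_base s le_rfl le_rfl]
  · intro k hk
    have := h2 (phi m k + 2 * m k) (by have := phi_lt m hk; have := I.len; omega)
    rw [I.st k hk, I.H_base s hk.le le_rfl] at this
    exact this
  · intro k hk
    have hkV := I.xpk_lt hk
    have hm := I.pk k hk
    have := h3 _ (I.pk_top hkV.le hm)
    rw [I.H_top s hkV.le hm] at this
    push_cast at this; omega

lemma val_up (I : Ins x V m p n) {s : ℤ} {ν : ℕ} (hs : 0 ≤ s) (hsν : s ≤ ν)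
    (hx : Val ν s 0 x V) : Val (ν + 1) s 0 p n := by
  refine ⟨?_, ?_, ?_⟩
  · rw [← hx.1, I.len, I.H_base s le_rfl le_rfl]
  · intro k hk
    rcases I.loc k hk.le with ⟨v, j, g1, g2, g3⟩ | ⟨v, j, g1, g2, g3⟩
    · rcases g2.lt_or_eq with h | h
      · rw [g3, I.up v g1 j h]
        constructor <;> intro h <;> exact absurd h (by decide)
      · have hvV : v < V := by
          rcases g1.lt_or_eq with h' | h'
          · exact h'
          · have := I.len; subst h' h; omega
        rw [g3, h, I.st v hvV, I.H_base s g1 le_rfl]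
        exact hx.2.1 v hvV
    · rw [g3, I.dn v g1 j g2, I.H_top s g1 g2]
      have := H_nonneg hs hx v g1
      refine ⟨fun _ => by omega, fun h => absurd h (by decide)⟩
  · intro k hk
    obtain ⟨v, j, g1, g2, g3⟩ := I.pk_loc hk
    rw [g3, I.H_top s g1 g2]
    have := H_le hs hsν hx v g1
    push_cast; omega

lemma cnt_succ (I : Ins x V m p n) {s : ℤ} (hs : 0 ≤ s) {ν : ℕ} {b : ℤ} (hx : Val ν s b x V)
    (r : ℕ) : cnt s p n (r + 1 + 1) = cnt s x V (r + 1) := by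
  unfold cnt
  rw [I.sum_peaks]
  apply Finset.sum_congr rfl
  intro v hv
  have hv : v ≤ V := by simp at hv; omega
  by_cases hp : PK x v
  · have hm := I.pk v hp
    rw [if_pos hp, Finset.sum_eq_single 0]
    · simp only [I.MR_first hs hx hp]; simp
    · intro j hj hj0
      simp only [Finset.mem_range] at hj
      rw [if_neg]
      rw [I.MR_other hs hx hv hj (Or.inr (by omega))]
      omega
    · intro h; simp at h; omega
  · rw [if_neg hp]
    apply Finset.sum_eq_zero
    intro j hj
    simp only [Finset.mem_range] at hj
    rw [if_neg]
    rw [I.MR_other hs hx hv hj (Or.inl hp)]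
    omega

lemma cnt_one (I : Ins x V m p n) {s : ℤ} (hs : 0 ≤ s) {ν : ℕ} {b : ℤ} (hx : Val ν s b x V) :
    cnt s p n 1 + np x V = ∑ v ∈ Finset.range (V + 1), m v := by
  unfold cnt np
  rw [I.sum_peaks, ← Finset.sum_add_distrib]
  apply Finset.sum_congr rfl
  intro v hv
  have hv : v ≤ V := by simp at hv; omega
  by_cases hp : PK x v
  · have hm := I.pk v hp
    obtain ⟨k, hk⟩ : ∃ k, m v = k + 1 := ⟨m v - 1, by omega⟩
    rw [if_pos hp, hk, Finset.sum_range_succ']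
    rw [if_neg (by rw [show (1 : ℕ) = 0 + 1 from rfl, I.MR_first hs hx hp]; omega)]
    rw [Finset.sum_congr rfl (g := fun _ => 1)]
    · simp
    · intro j hj
      simp only [Finset.mem_range] at hj
      rw [if_pos]
      exact (I.MR_other hs hx hv (by omega) (Or.inr (by omega)) (r := 0)).2 rfl
  · rw [if_neg hp, Finset.sum_congr rfl (g := fun _ => 1)]
    · simp
    · intro j hj
      simp only [Finset.mem_range] at hj
      rw [if_pos]
      exact (I.MR_other hs hx hv (by omega) (Or.inl hp) (r := 0)).2 rfl

lemma sum_phi (m : ℕ → ℕ) (V : ℕ) :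
    ∑ v ∈ Finset.range V, ∑ j ∈ Finset.range (m v), (phi m v + 2 * j + 1) =
    (∑ v ∈ Finset.range V, m v) ^ 2 + ∑ v ∈ Finset.range V, v * m v := by
  have aux : ∀ c k : ℕ, ∑ j ∈ Finset.range k, (c + 2 * j + 1) = c * k + k ^ 2 := by
    intro c k
    induction k with
    | zero => simp
    | succ k ih => rw [Finset.sum_range_succ, ih]; ring
  induction V with
  | zero => simp
  | succ V ih =>
    simp only [Finset.sum_range_succ]
    rw [ih, aux, phi]
    ring

lemma wt_eq (I : Ins x V m p n) : wt p n =
    (∑ v ∈ Finset.range (V + 1), m v) ^ 2 + ∑ v ∈ Finset.range (V + 1), v * m v := by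
  unfold wt
  rw [I.sum_peaks, sum_phi]

end Ins

/-! encoding and decoding -/

def gd (p : List (Fin 3)) (i : ℕ) : Fin 3 := p.getD i 2

def rep : ℕ → List (Fin 3) → List (Fin 3)
  | 0, r => r
  | k + 1, r => 0 :: 1 :: rep k r

def enc : List (Fin 3) → (ℕ → ℕ) → List (Fin 3)
  | [], m => rep (m 0) []
  | a :: x, m => rep (m 0) (a :: enc x (fun i => m (i + 1)))

def consM (m : ℕ → ℕ) : ℕ → ℕ
  | 0 => 0
  | i + 1 => m i

def incM (k : ℕ) (m : ℕ → ℕ) (i : ℕ) : ℕ := if i = 0 then m 0 + k else m i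

def dec : List (Fin 3) → List (Fin 3) × (ℕ → ℕ)
  | [] => ([], fun _ => 0)
  | [a] => ([a], fun _ => 0)
  | a :: b :: r =>
    if a = 0 ∧ b = 1 then ((dec r).1, incM 1 (dec r).2)
    else (a :: (dec (b :: r)).1, consM (dec (b :: r)).2)

lemma gd_nil (i : ℕ) : gd [] i = 2 := by simp [gd]
lemma gd_zero (a : Fin 3) (r : List (Fin 3)) : gd (a :: r) 0 = a := by simp [gd]
lemma gd_succ (a : Fin 3) (r : List (Fin 3)) (i : ℕ) : gd (a :: r) (i + 1) = gd r i := by simp [gd]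
lemma gd_ge (p : List (Fin 3)) {i : ℕ} (h : p.length ≤ i) : gd p i = 2 := by
  simp [gd, h]

lemma rep_length (k : ℕ) (r : List (Fin 3)) : (rep k r).length = 2 * k + r.length := by
  induction k with
  | zero => simp [rep]
  | succ k ih => simp [rep, ih]; ring

lemma gd_rep_up (k : ℕ) (r : List (Fin 3)) (j : ℕ) (h : j < k) : gd (rep k r) (2 * j) = 0 := by
  induction k generalizing j with
  | zero => omega
  | succ k ih =>
    cases j with
    | zero => exact gd_zero _ _
    | succ j => exact ih j (by omega)

lemma gd_rep_dn (k : ℕ) (r : List (Fin 3)) (j : ℕ) (h : j < k) : gd (rep k r) (2 * j + 1) = 1 := by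
  induction k generalizing j with
  | zero => omega
  | succ k ih =>
    cases j with
    | zero => exact gd_zero 1 (rep k r)
    | succ j => exact ih j (by omega)

lemma gd_rep_add (k : ℕ) (r : List (Fin 3)) (i : ℕ) : gd (rep k r) (2 * k + i) = gd r i := by
  induction k with
  | zero => simp [rep]
  | succ k ih =>
    rw [show 2 * (k + 1) + i = 2 * k + i + 1 + 1 by ring]
    exact ih

lemma phi_succ' (m : ℕ → ℕ) (v : ℕ) :
    phi m (v + 1) = 2 * m 0 + (phi (fun i => m (i + 1)) v + 1) := by
  simp [phi, Finset.sum_range_succ']; ring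

lemma enc_up (x : List (Fin 3)) (m : ℕ → ℕ) (v : ℕ) (hv : v ≤ x.length) (j : ℕ) (hj : j < m v) :
    gd (enc x m) (phi m v + 2 * j) = 0 := by
  induction x generalizing m v with
  | nil =>
    simp at hv; subst hv
    rw [phi_zero, Nat.zero_add]; exact gd_rep_up _ _ _ hj
  | cons a x ih =>
    cases v with
    | zero => rw [phi_zero, Nat.zero_add]; exact gd_rep_up _ _ _ hj
    | succ v =>
      rw [phi_succ', enc, add_assoc, gd_rep_add, add_right_comm, gd_succ]
      exact ih _ v (by simpa using hv) hj

lemma enc_dn (x : List (Fin 3)) (m : ℕ → ℕ) (v : ℕ) (hv : v ≤ x.length) (j : ℕ) (hj : j < m v) :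
    gd (enc x m) (phi m v + 2 * j + 1) = 1 := by
  induction x generalizing m v with
  | nil =>
    simp at hv; subst hv
    rw [phi_zero, Nat.zero_add]; exact gd_rep_dn _ _ _ hj
  | cons a x ih =>
    cases v with
    | zero => rw [phi_zero, Nat.zero_add]; exact gd_rep_dn _ _ _ hj
    | succ v =>
      rw [phi_succ', enc, add_assoc, add_assoc, gd_rep_add]
      rw [show phi (fun i => m (i + 1)) v + 1 + (2 * j + 1) = phi (fun i => m (i + 1)) v + 2 * j + 1 + 1 by ring,
        gd_succ]
      exact ih _ v (by simpa using hv) hj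

lemma enc_st (x : List (Fin 3)) (m : ℕ → ℕ) (v : ℕ) (hv : v < x.length) :
    gd (enc x m) (phi m v + 2 * m v) = gd x v := by
  induction x generalizing m v with
  | nil => simp at hv
  | cons a x ih =>
    cases v with
    | zero =>
      rw [phi_zero, Nat.zero_add]
      exact (gd_rep_add _ _ 0).trans (by rw [gd_zero, gd_zero])
    | succ v =>
      rw [phi_succ', enc, add_assoc, gd_rep_add, add_right_comm, gd_succ, gd_succ]
      exact ih _ v (by simpa using hv)

lemma enc_len (x : List (Fin 3)) (m : ℕ → ℕ) :
    (enc x m).length = phi m x.length + 2 * m x.length := by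
  induction x generalizing m with
  | nil => simp [enc, rep_length, phi_zero]
  | cons a x ih =>
    rw [enc, rep_length, List.length_cons, List.length_cons, ih, phi_succ']; ring

lemma enc_ins (x : List (Fin 3)) (m : ℕ → ℕ) (hpk : ∀ v, PK (gd x) v → 1 ≤ m v) :
    Ins (gd x) x.length m (gd (enc x m)) (enc x m).length where
  up := enc_up x m
  dn := enc_dn x m
  st := enc_st x m
  len := enc_len x m
  xe := fun _ h => gd_ge _ h
  pe := fun _ h => gd_ge _ h
  pk := hpk

lemma enc_head (x : List (Fin 3)) (m : ℕ → ℕ) (h : gd (enc x m) 0 = 1) : m 0 = 0 ∧ gd x 0 = 1 := by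
  have h0 : m 0 = 0 := by
    by_contra h0
    have := enc_up x m 0 (by omega) 0 (by omega)
    rw [phi_zero] at this
    simp [h] at this
  refine ⟨h0, ?_⟩
  cases x with
  | nil => simpa [enc, h0, rep] using h
  | cons a x => simpa [enc, h0, rep, gd_zero] using h

lemma dec_cons (a : Fin 3) (r : List (Fin 3)) (h : ¬ (a = 0 ∧ gd r 0 = 1)) :
    dec (a :: r) = (a :: (dec r).1, consM (dec r).2) := by
  cases r with
  | nil =>
    simp only [dec, Prod.mk.injEq, true_and]
    funext i; cases i <;> rfl
  | cons b r =>
    rw [gd_zero] at h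
    rw [dec, if_neg h]

lemma dec_rep (k : ℕ) (r : List (Fin 3)) : dec (rep k r) = ((dec r).1, incM k (dec r).2) := by
  induction k with
  | zero =>
    rw [rep]
    ext1
    · rfl
    · funext i; simp only [incM]; split_ifs with h
      · subst h; rfl
      · rfl
  | succ k ih =>
    rw [rep, dec, if_pos ⟨rfl, rfl⟩, ih]
    ext1
    · rfl
    · funext i; simp only [incM]; split_ifs <;> simp [add_assoc]

lemma PK_cons_succ (a : Fin 3) (x : List (Fin 3)) (v : ℕ) (h : 1 ≤ v) :
    PK (gd (a :: x)) (v + 1) ↔ PK (gd x) v := by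
  unfold PK
  obtain ⟨v, rfl⟩ : ∃ w, v = w + 1 := ⟨v - 1, by omega⟩
  simp only [Nat.add_sub_cancel, gd_succ]
  simp

lemma PK_cons_one (a : Fin 3) (x : List (Fin 3)) :
    PK (gd (a :: x)) 1 ↔ a = 0 ∧ gd x 0 = 1 := by
  unfold PK
  rw [show 1 - 1 = 0 from rfl, gd_zero, show (1 : ℕ) = 0 + 1 from rfl, gd_succ]
  simp

lemma dec_enc (x : List (Fin 3)) (m : ℕ → ℕ) (hpk : ∀ v, PK (gd x) v → 1 ≤ m v)
    (hm : ∀ v, x.length < v → m v = 0) : dec (enc x m) = (x, m) := by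
  induction x generalizing m with
  | nil =>
    rw [enc, dec_rep]
    ext1
    · rfl
    · funext i; simp only [incM, dec]
      split_ifs with h
      · subst h; simp
      · exact (hm i (by simp; omega)).symm
  | cons a x ih =>
    rw [enc, dec_rep, dec_cons, ih]
    · ext1
      · rfl
      · funext i
        cases i with
        | zero => simp [incM, consM]
        | succ i => simp [incM, consM]
    · intro v hv
      exact hpk (v + 1) ((PK_cons_succ a x v hv.1).2 hv)
    · intro v hv
      exact hm (v + 1) (by simp; omega)
    · rintro ⟨ha, hh⟩
      obtain ⟨h1, h2⟩ := enc_head _ _ hh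
      have := hpk 1 ((PK_cons_one a x).2 ⟨ha, h2⟩)
      simp at h1
      omega

lemma enc_cons_incM (x : List (Fin 3)) (m : ℕ → ℕ) :
    enc x (incM 1 m) = 0 :: 1 :: enc x m := by
  cases x with
  | nil => simp [enc, incM, rep]
  | cons a x => simp [enc, incM, rep]

lemma dec_spec (p : List (Fin 3)) : enc (dec p).1 (dec p).2 = p ∧
    (∀ v, PK (gd (dec p).1) v → 1 ≤ (dec p).2 v) ∧
    (∀ v, (dec p).1.length < v → (dec p).2 v = 0) := by
  have main : ∀ n, ∀ p : List (Fin 3), p.length ≤ n → enc (dec p).1 (dec p).2 = p ∧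
    (∀ v, PK (gd (dec p).1) v → 1 ≤ (dec p).2 v) ∧
    (∀ v, (dec p).1.length < v → (dec p).2 v = 0) := by
    intro n
    induction n with
    | zero =>
      intro p hp
      have : p = [] := List.eq_nil_of_length_eq_zero (by omega)
      subst this
      refine ⟨rfl, ?_, fun _ _ => rfl⟩
      rintro v ⟨_, _, h⟩
      simp [dec, gd_nil] at h
    | succ n ih =>
      intro p hp
      cases p with
      | nil =>
        refine ⟨rfl, ?_, fun _ _ => rfl⟩
        rintro v ⟨_, _, h⟩
        simp [dec, gd_nil] at h
      | cons a r =>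
        by_cases hc : a = 0 ∧ gd r 0 = 1
        · cases r with
          | nil => simp [gd_nil] at hc
          | cons b r =>
            rw [gd_zero] at hc
            obtain ⟨h1, h2, h3⟩ := ih r (by simp at hp; omega)
            rw [dec, if_pos hc]
            refine ⟨?_, ?_, ?_⟩
            · simp only []
              rw [enc_cons_incM, h1, hc.1, hc.2]
            · intro v hv
              have := h2 v hv
              simp only [incM]; split_ifs <;> omega
            · intro v hv
              have := h3 v hv
              simp only [incM]; rw [if_neg (by omega)]; exact this
        · obtain ⟨h1, h2, h3⟩ := ih r (by simp at hp; omega)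
          rw [dec_cons a r hc]
          refine ⟨?_, ?_, ?_⟩
          · simp only [enc, consM, rep]
            rw [h1]
          · intro v hv
            simp only [] at hv ⊢
            rcases v with _ | _ | v
            · exact absurd hv.1 (by omega)
            · rw [zero_add, PK_cons_one] at hv
              show 1 ≤ (dec r).2 0
              by_contra h0
              apply hc
              refine ⟨hv.1, ?_⟩
              rw [← h1]
              cases hx : (dec r).1 with
              | nil => rw [hx, gd_nil] at hv; exact absurd hv.2 (by decide)
              | cons b x =>
                rw [hx, gd_zero] at hv
                rw [enc, show (dec r).2 0 = 0 by omega, rep, gd_zero]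
                exact hv.2
            · exact h2 (v + 1) ((PK_cons_succ a _ (v + 1) (by omega)).1 hv)
          · intro v hv
            cases v with
            | zero => rfl
            | succ v => exact h3 v (by simp at hv; omega)
  exact main p.length p le_rfl

/-! generating function -/

lemma qP_succ (n : ℕ) : qP (RatFunc.X : K) (n + 1) = qP (RatFunc.X : K) n * (1 - RatFunc.X ^ (n + 1)) := by
  simp [qP, Finset.prod_range_succ]

lemma one_sub_ne (n : ℕ) : (1 - RatFunc.X ^ (n + 1) : K) ≠ 0 := by
  intro h
  have h1 : (algebraMap (Polynomial ℚ) K) (1 - Polynomial.X ^ (n + 1)) = 0 := by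
    rw [map_sub, map_pow, RatFunc.algebraMap_X, map_one]; exact h
  rw [map_eq_zero_iff _ (RatFunc.algebraMap_injective ℚ)] at h1
  have := congrArg (Polynomial.eval 0) h1
  simp at this

lemma qP_ne (n : ℕ) : qP (RatFunc.X : K) n ≠ 0 :=
  Finset.prod_ne_zero_iff.2 fun j _ => one_sub_ne j

def gb (V n : ℕ) : K := qP (RatFunc.X : K) (n + V) / (qP (RatFunc.X : K) n * qP (RatFunc.X : K) V)

lemma gb_zero_left (n : ℕ) : gb 0 n = 1 := by
  have := qP_ne n
  simp [gb, qP] at this ⊢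
  exact this

lemma gb_zero_right (V : ℕ) : gb V 0 = 1 := by
  have := qP_ne V
  simp [gb, qP] at this ⊢
  exact this

lemma gb_rec (V n : ℕ) : gb (V + 1) (n + 1) = gb (V + 1) n + RatFunc.X ^ (n + 1) * gb V (n + 1) := by
  unfold gb
  have h1 := qP_ne n
  have h2 := qP_ne V
  have h3 := one_sub_ne n
  have h4 := one_sub_ne V
  rw [show n + 1 + (V + 1) = n + V + 1 + 1 by ring, show n + (V + 1) = n + V + 1 by ring,
    show n + 1 + V = n + V + 1 by ring, qP_succ (n + V + 1), qP_succ n, qP_succ V]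
  field_simp
  ring

lemma gb_sum (V n : ℕ) : ∑ i ∈ Finset.range (n + 1), RatFunc.X ^ i * gb V i = gb (V + 1) n := by
  induction n with
  | zero => simp [gb_zero_right]
  | succ n ih => rw [Finset.sum_range_succ, ih, gb_rec]

lemma gen (V n : ℕ) : ∑ e ∈ Finset.Nat.antidiagonalTuple (V + 1) n,
    (RatFunc.X : K) ^ (∑ v : Fin (V + 1), (v : ℕ) * e v) = gb V n := by
  induction V generalizing n with
  | zero => simp [gb_zero_left]
  | succ V ih =>
    rw [← gb_sum]
    simp only [← ih, Finset.mul_sum]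
    rw [Finset.sum_sigma']
    symm
    apply Finset.sum_bij (fun a _ => (Fin.cons (n - a.1) a.2 : Fin (V + 1 + 1) → ℕ))
    · rintro ⟨i, e⟩ h
      simp only [Finset.mem_sigma, Finset.mem_range, Finset.Nat.mem_antidiagonalTuple] at h ⊢
      rw [Fin.sum_univ_succ]
      simp only [Fin.cons_zero, Fin.cons_succ]
      omega
    · rintro ⟨i, e⟩ h ⟨i', e'⟩ h' heq
      simp only [Finset.mem_sigma, Finset.mem_range, Finset.Nat.mem_antidiagonalTuple] at h h'
      obtain ⟨h1, h2⟩ := Fin.cons_inj.1 heq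
      simp only at h1 h2
      subst h2
      have : i = i' := by omega
      subst this; rfl
    · intro e he
      rw [Finset.Nat.mem_antidiagonalTuple, Fin.sum_univ_succ] at he
      refine ⟨⟨n - e 0, Fin.tail e⟩, ?_, ?_⟩
      · simp only [Finset.mem_sigma, Finset.mem_range, Finset.Nat.mem_antidiagonalTuple, Fin.tail]
        omega
      · simp only
        rw [show n - (n - e 0) = e 0 by omega]
        exact Fin.cons_self_tail e
    · rintro ⟨i, e⟩ h
      simp only [Finset.mem_sigma, Finset.mem_range, Finset.Nat.mem_antidiagonalTuple] at h
      rw [← pow_add, Fin.sum_univ_succ (n := V + 1)]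
      congr 1
      simp only [Fin.cons_succ, Fin.val_zero, Fin.val_succ, zero_mul, zero_add, add_mul,
        Finset.sum_add_distrib, one_mul]
      omega

def extE {n : ℕ} (e : Fin n → ℕ) (v : ℕ) : ℕ := if h : v < n then e ⟨v, h⟩ else 0

def MM {V : ℕ} (x : Fin V → Fin 3) (e : Fin (V + 1) → ℕ) (v : ℕ) : ℕ :=
  extE e v + if PK (ext x) v then 1 else 0

lemma gd_ofFn {n : ℕ} (d : Fin n → Fin 3) : gd (List.ofFn d) = ext d := by
  funext i
  unfold gd ext
  split_ifs with h
  · simp [List.getD, h]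
  · simp [List.getD, h]

lemma ext_gd {n : ℕ} (p : List (Fin 3)) (h : p.length = n) : ext (fun k : Fin n => gd p k) = gd p := by
  funext i
  unfold ext
  split_ifs with hi
  · rfl
  · rw [gd_ge]; omega

lemma ofFn_gd {n : ℕ} (p : List (Fin 3)) (h : p.length = n) :
    List.ofFn (fun k : Fin n => gd p k) = p := by
  subst h
  apply List.ext_getElem
  · simp
  · intro i h1 h2
    simp [gd]

lemma extE_sum {n : ℕ} (e : Fin n → ℕ) (g : ℕ → ℕ) :
    ∑ v ∈ Finset.range n, g v * extE e v = ∑ v : Fin n, g v * e v := by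
  rw [Finset.sum_range]
  apply Finset.sum_congr rfl
  intro v _
  simp [extE]

lemma MM_sum {V : ℕ} (x : Fin V → Fin 3) (e : Fin (V + 1) → ℕ) :
    ∑ v ∈ Finset.range (V + 1), MM x e v = ∑ v, e v + np (ext x) V := by
  unfold MM np
  rw [Finset.sum_add_distrib]
  have := extE_sum e (fun _ => 1)
  simp only [one_mul] at this
  rw [this]

lemma MM_wsum {V : ℕ} (x : Fin V → Fin 3) (e : Fin (V + 1) → ℕ) :
    ∑ v ∈ Finset.range (V + 1), v * MM x e v = ∑ v : Fin (V + 1), (v : ℕ) * e v + wt (ext x) V := by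
  unfold MM wt
  simp only [mul_add, Finset.sum_add_distrib]
  rw [extE_sum e (fun v => v)]
  simp

lemma phi_len (m : ℕ → ℕ) (V : ℕ) : phi m V + 2 * m V = V + 2 * ∑ v ∈ Finset.range (V + 1), m v := by
  rw [phi, Finset.sum_range_succ]; ring

lemma Good_up {x : ℕ → Fin 3} {V : ℕ} {m : ℕ → ℕ} {p : ℕ → Fin 3} {n : ℕ} (I : Ins x V m p n)
    {ν : ℕ} {y : ℤ} (hy : 0 ≤ y) (hyν : y ≤ ν) (nn : Fin (ν + 1) → ℕ) :
    Good (ν + 1) y p n nn ↔ Good ν y x V (Fin.tail nn) ∧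
      ∑ v ∈ Finset.range (V + 1), m v = ∑ j, nn j := by
  have key : ∀ hx : Val ν y 0 x V, (∀ j : Fin ν, cnt y x V ((j : ℕ) + 1) = Fin.tail nn j) →
      (cnt y p n 1 = nn 0 ↔ ∑ v ∈ Finset.range (V + 1), m v = ∑ j, nn j) := by
    intro hx hc
    have h1 := np_eq hy I.xe (⟨hx, hc⟩ : Good ν y x V (Fin.tail nn))
    have h2 := I.cnt_one hy hx
    rw [Fin.sum_univ_succ]
    simp only [Fin.tail] at h1
    omega
  constructor
  · rintro ⟨h1, h2⟩
    have hx := I.val_down h1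
    have hc : ∀ j : Fin ν, cnt y x V ((j : ℕ) + 1) = Fin.tail nn j := by
      intro j
      rw [← I.cnt_succ hy hx]
      exact h2 j.succ
    exact ⟨⟨hx, hc⟩, (key hx hc).1 (h2 0)⟩
  · rintro ⟨⟨hx, hc⟩, h⟩
    refine ⟨I.val_up hy hyν hx, ?_⟩
    intro j
    refine Fin.cases ?_ (fun j => ?_) j
    · exact (key hx hc).2 h
    · rw [Fin.val_succ, I.cnt_succ hy hx]; exact hc j

lemma decomp {ν : ℕ} {y : ℤ} (hy : 0 ≤ y) (hyν : y ≤ ν) (nn : Fin (ν + 1) → ℕ) {L : ℕ}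
    (d : Fin L → Fin 3) (hd : Good (ν + 1) y (ext d) L nn) :
    ∃ (x : List (Fin 3)) (m : ℕ → ℕ), enc x m = List.ofFn d ∧ (∀ v, PK (gd x) v → 1 ≤ m v) ∧
      (∀ v, x.length < v → m v = 0) ∧ Good ν y (gd x) x.length (Fin.tail nn) ∧
      ∑ v ∈ Finset.range (x.length + 1), m v = ∑ j, nn j ∧ L = x.length + 2 * ∑ j, nn j := by
  obtain ⟨h1, h2, h3⟩ := dec_spec (List.ofFn d)
  have I := enc_ins _ _ h2
  rw [h1, gd_ofFn, List.length_ofFn] at I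
  obtain ⟨g1, g2⟩ := (Good_up I hy hyν nn).1 hd
  refine ⟨_, _, h1, h2, h3, g1, g2, ?_⟩
  rw [← g2, ← phi_len]; exact I.len

lemma S_neg {ν : ℕ} {y : ℤ} (hy : 0 ≤ y) (hyν : y ≤ ν) (nn : Fin (ν + 1) → ℕ) {L : ℕ}
    (hL : L < 2 * ∑ j, nn j) : S (ν + 1) y L nn = 0 := by
  unfold S
  apply Finset.sum_eq_zero
  intro d hd
  obtain ⟨x, m, _, _, _, _, _, h⟩ := decomp hy hyν nn d (by simpa using hd)
  omega

lemma MM_ins {V : ℕ} (x : Fin V → Fin 3) (e : Fin (V + 1) → ℕ) :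
    Ins (ext x) V (MM x e) (gd (enc (List.ofFn x) (MM x e))) (enc (List.ofFn x) (MM x e)).length := by
  have := enc_ins (List.ofFn x) (MM x e) (by
    intro v hv; rw [gd_ofFn] at hv; simp [MM, hv])
  rw [gd_ofFn, List.length_ofFn] at this
  exact this

lemma MM_dec {V : ℕ} (x : Fin V → Fin 3) (e : Fin (V + 1) → ℕ) :
    dec (enc (List.ofFn x) (MM x e)) = (List.ofFn x, MM x e) := by
  apply dec_enc
  · intro v hv; rw [gd_ofFn] at hv; simp [MM, hv]
  · intro v hv
    rw [List.length_ofFn] at hv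
    have : ¬ PK (ext x) v := by
      rintro ⟨_, _, h⟩
      rw [ext_ge x hv.le] at h
      exact absurd h (by decide)
    simp [MM, this, extE]
    intro h; omega

lemma S_step {ν : ℕ} {y : ℤ} (hy : 0 ≤ y) (hyν : y ≤ ν) (nn : Fin (ν + 1) → ℕ) (V : ℕ) :
    S (ν + 1) y (V + 2 * ∑ j, nn j) nn =
      RatFunc.X ^ ((∑ j, nn j) ^ 2) * gb V (nn 0) * S ν y V (Fin.tail nn) := by
  obtain ⟨N, hN⟩ : ∃ N, N = ∑ j, nn j := ⟨_, rfl⟩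
  rw [← hN]
  rw [← gen]
  unfold S
  rw [mul_assoc, mul_comm (∑ e ∈ Finset.Nat.antidiagonalTuple (V + 1) (nn 0), _),
    Finset.sum_mul_sum, Finset.mul_sum]
  simp only [Finset.mul_sum]
  rw [← Finset.sum_product']
  have facts : ∀ (x : Fin V → Fin 3) (e : Fin (V + 1) → ℕ), Good ν y (ext x) V (Fin.tail nn) →
      ∑ v, e v = nn 0 → ∑ v ∈ Finset.range (V + 1), MM x e v = N ∧
        (enc (List.ofFn x) (MM x e)).length = V + 2 * N := by
    intro x e hx he
    have h1 : ∑ v ∈ Finset.range (V + 1), MM x e v = N := by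
      rw [MM_sum, he, np_eq hy (fun i h => ext_ge x h) hx, hN, Fin.sum_univ_succ]; rfl
    refine ⟨h1, ?_⟩
    rw [(MM_ins x e).len, phi_len, h1]
  symm
  apply Finset.sum_bij (fun a _ => fun k : Fin (V + 2 * N) => gd (enc (List.ofFn a.1) (MM a.1 a.2)) k)
  · rintro ⟨x, e⟩ h
    simp only [Finset.mem_product, Finset.mem_filter, Finset.mem_univ, true_and,
      Finset.Nat.mem_antidiagonalTuple] at h ⊢
    obtain ⟨f1, f2⟩ := facts x e h.1 h.2
    rw [ext_gd _ f2]
    have I := MM_ins x e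
    rw [f2] at I
    exact (Good_up I hy hyν nn).2 ⟨h.1, f1.trans hN⟩
  · rintro ⟨x, e⟩ h ⟨x', e'⟩ h' heq
    simp only [Finset.mem_product, Finset.mem_filter, Finset.mem_univ, true_and,
      Finset.Nat.mem_antidiagonalTuple] at h h'
    obtain ⟨f1, f2⟩ := facts x e h.1 h.2
    obtain ⟨f1', f2'⟩ := facts x' e' h'.1 h'.2
    have := congrArg List.ofFn heq
    simp only at this
    rw [ofFn_gd _ f2, ofFn_gd _ f2'] at this
    have := congrArg dec this
    rw [MM_dec, MM_dec, Prod.mk.injEq] at this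
    obtain ⟨t1, t2⟩ := this
    have t1 := List.ofFn_injective t1
    subst t1
    have : e = e' := by
      funext v
      have := congrFun t2 v
      have hv : (v : ℕ) ≤ V := by omega
      simpa [MM, extE, hv] using this
    subst this; rfl
  · intro d hd
    simp only [Finset.mem_filter, Finset.mem_univ, true_and] at hd
    obtain ⟨x, m, h1, h2, h3, h4, h5, h6⟩ := decomp hy hyν nn d hd
    have hV : x.length = V := by omega
    have hx : ext (fun k : Fin V => gd x k) = gd x := ext_gd x hV
    have hM : MM (fun k : Fin V => gd x k)
        (fun v : Fin (V + 1) => m v - if PK (gd x) v then 1 else 0) = m := by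
      funext v
      unfold MM extE
      rw [hx]
      by_cases hv : v < V + 1
      · rw [dif_pos hv]
        simp only
        by_cases hp : PK (gd x) v
        · have := h2 v hp
          simp only [hp, if_true]; omega
        · simp [hp]
      · rw [dif_neg hv, h3 v (by omega), if_neg]
        intro hp
        have := h2 v hp
        have := h3 v (by omega)
        omega
    rw [hV] at h5 h4
    refine ⟨⟨fun k => gd x k, fun v => m v - if PK (gd x) v then 1 else 0⟩, ?_, ?_⟩
    · simp only [Finset.mem_product, Finset.mem_filter, Finset.mem_univ, true_and,
        Finset.Nat.mem_antidiagonalTuple]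
      rw [hx]
      refine ⟨h4, ?_⟩
      have := MM_sum (fun k : Fin V => gd x k)
        (fun v : Fin (V + 1) => m v - if PK (gd x) v then 1 else 0)
      rw [hM, hx, np_eq hy (fun i h => gd_ge x (by omega)) h4, h5, Fin.sum_univ_succ nn] at this
      simp only [Fin.tail] at this
      omega
    · simp only
      rw [hM, ofFn_gd x hV, h1, gd_ofFn]
      funext k
      exact ext_lt d k.2
  · rintro ⟨x, e⟩ h
    simp only [Finset.mem_product, Finset.mem_filter, Finset.mem_univ, true_and,
      Finset.Nat.mem_antidiagonalTuple] at h
    obtain ⟨f1, f2⟩ := facts x e h.1 h.2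
    simp only
    rw [ext_gd _ f2]
    have I := MM_ins x e
    rw [f2] at I
    rw [I.wt_eq, f1, MM_wsum, ← pow_add, ← pow_add]
    congr 1; ring

lemma S_base (L : ℕ) (nn : Fin 0 → ℕ) : S 0 0 L nn = 1 := by
  unfold S
  have hpk : ∀ k, ¬ PK (ext (fun _ : Fin L => (2 : Fin 3))) k := by
    rintro k ⟨_, _, h⟩
    unfold ext at h
    split_ifs at h <;> exact absurd (show (2 : Fin 3) = 1 from h) (by decide)
  have hH : ∀ k, H 0 (ext (fun _ : Fin L => (2 : Fin 3))) k = 0 := by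
    intro k
    unfold H ext
    simp [stepVal]
  have : (Finset.univ.filter (fun d : Fin L → Fin 3 => Good 0 0 (ext d) L nn)) = {fun _ => 2} := by
    ext d
    simp only [Finset.mem_filter, Finset.mem_univ, true_and, Finset.mem_singleton]
    constructor
    · rintro ⟨hv, -⟩
      funext k
      have a := H_le le_rfl (by simp) hv
      have b := H_nonneg le_rfl hv
      have e := H_succ 0 (ext d) k
      have a1 := a k k.2.le
      have b1 := b k k.2.le
      have a2 := a (k + 1) k.2
      have b2 := b (k + 1) k.2
      rw [ext_lt d k.2] at e
      push_cast at a1 a2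
      rcases fin3 (d k) with h | h | h
      · simp only [Fin.eta] at e; rw [h, stepVal_0] at e; omega
      · simp only [Fin.eta] at e; rw [h, stepVal_1] at e; omega
      · exact h
    · rintro rfl
      refine ⟨⟨hH L, ?_, ?_⟩, fun j => j.elim0⟩
      · intro k hk
        rw [ext_lt _ hk, hH]
        exact ⟨fun h => absurd h (by decide), fun _ => rfl⟩
      · intro k hk; exact absurd hk (hpk k)
  rw [this, Finset.sum_singleton]
  unfold wt
  simp [hpk]

/-! the case `s = 0` -/

section shift
variable {f g : ℕ → Fin 3} (h0 : g 0 = 1) (hs : ∀ i, g (i + 1) = f i)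

lemma H_shift (h0 : g 0 = 1) (hs : ∀ i, g (i + 1) = f i) (y : ℤ) (k : ℕ) :
    H y g (k + 1) = H (y - 1) f k := by
  induction k with
  | zero => rw [H_succ, H_zero, H_zero, h0, stepVal_1]; ring
  | succ k ih => rw [H_succ, ih, hs, H_succ]

lemma PK_shift (h0 : g 0 = 1) (hs : ∀ i, g (i + 1) = f i) (k : ℕ) : PK g (k + 1) ↔ PK f k := by
  unfold PK
  cases k with
  | zero => simp [h0]
  | succ k => simp [hs]

lemma Val_shift (h0 : g 0 = 1) (hs : ∀ i, g (i + 1) = f i) (ν : ℕ) (hν : 1 ≤ ν) (n : ℕ) :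
    Val ν ν 0 g (n + 1) ↔ Val ν ((ν : ℤ) - 1) 0 f n := by
  unfold Val
  rw [H_shift h0 hs]
  refine and_congr Iff.rfl (and_congr ?_ ?_)
  · constructor
    · intro h k hk
      have := h (k + 1) (by omega)
      rwa [H_shift h0 hs, hs] at this
    · intro h k hk
      cases k with
      | zero =>
        rw [h0, H_zero]
        exact ⟨fun _ => by omega, fun h => absurd h (by decide)⟩
      | succ k =>
        rw [H_shift h0 hs, hs]; exact h k (by omega)
  · constructor
    · intro h k hk
      have := h (k + 1) ((PK_shift h0 hs k).2 hk)
      rwa [H_shift h0 hs] at this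
    · intro h k hk
      cases k with
      | zero => exact absurd hk.1 (by omega)
      | succ k =>
        rw [H_shift h0 hs]; exact h k ((PK_shift h0 hs k).1 hk)

lemma RP_shift (h0 : g 0 = 1) (hs : ∀ i, g (i + 1) = f i) (y : ℤ) (n k t : ℕ)
    (hk : H (y - 1) f k ≤ y) : RP y g (n + 1) (k + 1) t ↔ RP (y - 1) f n k t := by
  constructor
  · rintro ⟨ht, a, c, h1, h2, h3, h4, h5, h6⟩
    rw [H_shift h0 hs] at h4 h5
    cases a with
    | zero => rw [H_zero] at h4; omega
    | succ a =>
      cases c with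
      | zero => omega
      | succ c =>
        rw [H_shift h0 hs] at h4 h5
        refine ⟨ht, a, c, by omega, by omega, by omega, h4, h5, ?_⟩
        intro m m1 m2 hm
        have := h6 (m + 1) (by omega) (by omega) ((PK_shift h0 hs m).2 hm)
        rw [H_shift h0 hs, H_shift h0 hs] at this
        exact ⟨this.1, fun e => by have := this.2 e; omega⟩
  · rintro ⟨ht, a, c, h1, h2, h3, h4, h5, h6⟩
    refine ⟨ht, a + 1, c + 1, by omega, by omega, by omega, ?_, ?_, ?_⟩
    · rw [H_shift h0 hs, H_shift h0 hs]; exact h4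
    · rw [H_shift h0 hs, H_shift h0 hs]; exact h5
    · intro m m1 m2 hm
      cases m with
      | zero => omega
      | succ m =>
        have := h6 m (by omega) (by omega) ((PK_shift h0 hs m).1 hm)
        rw [H_shift h0 hs, H_shift h0 hs]
        exact ⟨this.1, fun e => by have := this.2 e; omega⟩

lemma sum_shift (h0 : g 0 = 1) (hs : ∀ i, g (i + 1) = f i) (n : ℕ) (u : ℕ → ℕ) :
    (∑ k ∈ Finset.range (n + 1 + 1), if PK g k then u k else 0) =
    ∑ k ∈ Finset.range (n + 1), if PK f k then u (k + 1) else 0 := by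
  rw [Finset.sum_range_succ', if_neg (fun h => absurd h.1 (by omega)), add_zero]
  apply Finset.sum_congr rfl
  intro k _
  have := PK_shift h0 hs k
  by_cases h : PK f k <;> simp [this, h]

lemma Good_shift (h0 : g 0 = 1) (hs : ∀ i, g (i + 1) = f i) (ν : ℕ) (hν : 1 ≤ ν) (n : ℕ)
    (nn : Fin ν → ℕ) : Good ν ν g (n + 1) nn ↔ Good ν ((ν : ℤ) - 1) f n nn := by
  unfold Good
  rw [Val_shift h0 hs ν hν]
  refine and_congr_right fun hv => forall_congr' fun j => ?_
  have : cnt ν g (n + 1) ((j : ℕ) + 1) = cnt ((ν : ℤ) - 1) f n ((j : ℕ) + 1) := by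
    unfold cnt
    rw [sum_shift h0 hs]
    apply Finset.sum_congr rfl
    intro k _
    by_cases hk : PK f k
    · rw [if_pos hk, if_pos hk]
      have h1 := hv.2.2 k hk
      have : MR ν g (n + 1) (k + 1) ((j : ℕ) + 1) ↔ MR ((ν : ℤ) - 1) f n k ((j : ℕ) + 1) := by
        unfold MR
        simp only [RP_shift h0 hs _ _ _ _ h1]
      by_cases hm : MR ((ν : ℤ) - 1) f n k ((j : ℕ) + 1) <;> simp [this, hm]
    · rw [if_neg hk, if_neg hk]
  rw [this]

lemma wt_shift (h0 : g 0 = 1) (hs : ∀ i, g (i + 1) = f i) (n : ℕ) :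
    wt g (n + 1) = np f n + wt f n := by
  unfold wt np
  rw [sum_shift h0 hs, ← Finset.sum_add_distrib]
  apply Finset.sum_congr rfl
  intro k _
  split_ifs <;> omega

end shift

lemma S_zero (ν : ℕ) (hν : 1 ≤ ν) (nn : Fin ν → ℕ) : S ν ν 0 nn = 0 := by
  unfold S
  apply Finset.sum_eq_zero
  intro d hd
  simp only [Finset.mem_filter, Finset.mem_univ, true_and] at hd
  have := hd.1.1
  rw [H_zero] at this
  omega

lemma ext_cons_zero {L : ℕ} (d : Fin L → Fin 3) :
    ext (Fin.cons 1 d : Fin (L + 1) → Fin 3) 0 = 1 := by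
  rw [ext_lt _ (by omega)]; rfl

lemma ext_cons_succ {L : ℕ} (d : Fin L → Fin 3) (i : ℕ) :
    ext (Fin.cons 1 d : Fin (L + 1) → Fin 3) (i + 1) = ext d i := by
  by_cases h : i < L
  · rw [ext_lt _ h, ext_lt _ (by omega)]; rfl
  · rw [ext_ge _ (by omega), ext_ge _ (by omega)]

lemma S_shift (ν : ℕ) (hν : 1 ≤ ν) (L : ℕ) (nn : Fin ν → ℕ) :
    S ν ν (L + 1) nn = RatFunc.X ^ (∑ j, nn j) * S ν ((ν : ℤ) - 1) L nn := by
  unfold S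
  rw [Finset.mul_sum]
  symm
  apply Finset.sum_bij (fun d _ => (Fin.cons 1 d : Fin (L + 1) → Fin 3))
  · intro d hd
    simp only [Finset.mem_filter, Finset.mem_univ, true_and] at hd ⊢
    exact (Good_shift (ext_cons_zero d) (ext_cons_succ d) ν hν L nn).2 hd
  · intro d _ d' _ h
    exact (Fin.cons_inj.1 h).2
  · intro d hd
    simp only [Finset.mem_filter, Finset.mem_univ, true_and] at hd
    have hd0 : d 0 = 1 := by
      have e := H_succ ν (ext d) 0
      have l := H_le (by omega) le_rfl hd.1 1 (by omega)
      have v := hd.1.2.1 0 (by omega)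
      rw [ext_lt d (by omega), H_zero] at e v
      rcases fin3 (d 0) with h | h | h
      · change H _ _ 1 = ν + stepVal (d 0) at e
        rw [h, stepVal_0] at e; omega
      · exact h
      · have := v.2 h; omega
    have hc : (Fin.cons 1 (Fin.tail d) : Fin (L + 1) → Fin 3) = d := by
      rw [← hd0]; exact Fin.cons_self_tail d
    refine ⟨Fin.tail d, ?_, hc⟩
    simp only [Finset.mem_filter, Finset.mem_univ, true_and]
    rw [← hc] at hd
    exact (Good_shift (ext_cons_zero _) (ext_cons_succ _) ν hν L nn).1 hd
  · intro d hd
    simp only [Finset.mem_filter, Finset.mem_univ, true_and] at hd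
    rw [wt_shift (ext_cons_zero d) (ext_cons_succ d), pow_add,
      np_eq (by omega) (fun i h => ext_ge d h) hd]

/-! assembling -/

lemma sum_Icc_shift {M : Type*} [AddCommMonoid M] (f : ℕ → M) (a b : ℕ) :
    ∑ i ∈ Finset.Icc (a + 1) (b + 1), f i = ∑ i ∈ Finset.Icc a b, f (i + 1) := by
  rw [← Finset.map_add_right_Icc, Finset.sum_map]
  rfl

lemma sum_Icc_first {M : Type*} [AddCommMonoid M] (f : ℕ → M) (n : ℕ) :
    ∑ i ∈ Finset.Icc 1 (n + 1), f i = f 1 + ∑ i ∈ Finset.Icc 1 n, f (i + 1) := by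
  induction n with
  | zero => simp
  | succ n ih =>
    rw [Finset.sum_Icc_succ_top (by omega), ih, Finset.sum_Icc_succ_top (by omega), add_assoc]

lemma NN_one {ν : ℕ} (nn : Fin ν → ℕ) : NN nn 1 = ∑ j, nn j := by
  simp [NN]

lemma NN_succ {ν : ℕ} (nn : Fin (ν + 1) → ℕ) (i : ℕ) (hi : 1 ≤ i) :
    NN nn (i + 1) = NN (Fin.tail nn) i := by
  unfold NN
  rw [Fin.sum_univ_succ, if_neg (by simp; omega), zero_add]
  apply Finset.sum_congr rfl
  intro k _
  simp [Fin.tail]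

lemma sum_NN_tail {M : Type*} [AddCommMonoid M] (g : ℕ → M) {ν : ℕ} (nn : Fin (ν + 1) → ℕ) (a b : ℕ)
    (ha : 1 ≤ a) : ∑ i ∈ Finset.Icc a b, g (NN nn (i + 1)) =
      ∑ i ∈ Finset.Icc a b, g (NN (Fin.tail nn) i) := by
  apply Finset.sum_congr rfl
  intro i hi
  rw [NN_succ nn i (by simp at hi; omega)]

lemma expAG_succ (ν s : ℕ) (nn : Fin (ν + 1) → ℕ) :
    expAG (ν + 1) (s + 1) nn = (∑ j, nn j) ^ 2 + expAG ν s (Fin.tail nn) := by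
  unfold expAG
  rw [sum_Icc_first, sum_Icc_shift, NN_one, sum_NN_tail (fun z => z ^ 2) nn 1 ν le_rfl,
    sum_NN_tail (fun z => z) nn (s + 1) ν (by omega)]
  ring

lemma expAG_zero (ν : ℕ) (nn : Fin (ν + 1) → ℕ) :
    expAG (ν + 1) 0 nn = (∑ j, nn j) + expAG (ν + 1) 1 nn := by
  unfold expAG
  rw [zero_add, sum_Icc_first (fun i => NN nn i), NN_one, sum_Icc_shift (fun i => NN nn i)]
  ring

def PR (ν s L : ℕ) (nn : Fin ν → ℕ) : K := ∏ i : Fin ν, qB (RatFunc.X : K)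
  ((nn i : ℤ) + (L : ℤ) - 2 * (∑ l ∈ Finset.Icc 1 ((i : ℕ) + 1), (NN nn l : ℤ)) -
    alph ((i : ℕ) + 1) s) (nn i)

lemma qB_neg (a b : ℤ) (h : a < b) : qB (RatFunc.X : K) a b = 0 := by
  unfold qB
  rw [if_neg (by omega)]

lemma qB_gb (V n : ℕ) : qB (RatFunc.X : K) ((n : ℤ) + V) n = gb V n := by
  unfold qB gb
  rw [if_pos (by omega)]
  congr 2 
  have : ((n : ℤ) + V - n).toNat = V := by omega
  rw [this]

lemma PR_neg (ν s L : ℕ) (nn : Fin (ν + 1) → ℕ) (h : (L : ℤ) < 2 * (∑ j, nn j : ℕ) + alph 1 s) :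
    PR (ν + 1) s L nn = 0 := by
  unfold PR
  apply Finset.prod_eq_zero (Finset.mem_univ 0)
  apply qB_neg
  simp only [Fin.val_zero, zero_add, Finset.Icc_self, Finset.sum_singleton, NN_one]
  omega

lemma PR_succ (ν s V : ℕ) (nn : Fin (ν + 1) → ℕ) :
    PR (ν + 1) (s + 1) (V + 2 * ∑ j, nn j) nn = gb V (nn 0) * PR ν s V (Fin.tail nn) := by
  unfold PR
  rw [Fin.prod_univ_succ]
  congr 1
  · rw [← qB_gb]
    congr 1
    simp only [Fin.val_zero, zero_add, Finset.Icc_self, Finset.sum_singleton, NN_one]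
    have : alph 1 (s + 1) = 0 := by unfold alph; push_cast; omega
    rw [this]; push_cast; ring
  · apply Finset.prod_congr rfl
    intro i _
    simp only [Fin.tail, Fin.val_succ]
    congr 1
    rw [sum_Icc_first, NN_one, sum_NN_tail (fun z => (z : ℤ)) nn _ _ le_rfl]
    have : alph ((i : ℕ) + 1 + 1) (s + 1) = alph ((i : ℕ) + 1) s := by
      unfold alph; push_cast; congr 1; ring
    rw [this]
    push_cast [Fin.tail]
    ring

lemma PR_zero (ν L : ℕ) (nn : Fin ν → ℕ) : PR ν 0 (L + 1) nn = PR ν 1 L nn := by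
  unfold PR
  apply Finset.prod_congr rfl
  intro i _
  congr 1
  have : alph ((i : ℕ) + 1) 0 = alph ((i : ℕ) + 1) 1 + 1 := by
    unfold alph; push_cast; omega
  rw [this]; push_cast; ring

theorem main (ν s L : ℕ) (hs : s ≤ ν) (nn : Fin ν → ℕ) :
    (RatFunc.X : K) ^ expAG ν s nn * PR ν s L nn = S ν ((ν : ℤ) - s) L nn := by
  induction ν generalizing s L with
  | zero =>
    obtain rfl : s = 0 := by omega
    have := S_base L nn
    simp [PR, expAG, this]
  | succ ν ih =>
    have pos : ∀ s L : ℕ, s ≤ ν → (RatFunc.X : K) ^ expAG (ν + 1) (s + 1) nn * PR (ν + 1) (s + 1) L nn =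
        S (ν + 1) ((ν : ℤ) - s) L nn := by
      intro s L hs
      by_cases hL : L < 2 * ∑ j, nn j
      · rw [S_neg (by omega) (by omega) nn hL, PR_neg, mul_zero]
        have : 0 ≤ alph 1 (s + 1) := le_max_left _ _
        omega
      · obtain ⟨V, rfl⟩ : ∃ V, L = V + 2 * ∑ j, nn j := ⟨L - 2 * ∑ j, nn j, by omega⟩
        rw [S_step (by omega) (by omega), PR_succ, expAG_succ, ← ih s V hs, pow_add]
        ring
    cases s with
    | succ s =>
      rw [pos s L (by omega)]
      congr 1; push_cast; ring
    | zero =>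
      have e : ((ν + 1 : ℕ) : ℤ) - (0 : ℕ) = ((ν + 1 : ℕ) : ℤ) := by simp
      rw [e]
      cases L with
      | zero =>
        rw [S_zero _ (by omega), PR_neg, mul_zero]
        have : alph 1 0 = 1 := by simp [alph]
        omega
      | succ L =>
        rw [S_shift _ (by omega), PR_zero, expAG_zero, pow_add, mul_assoc, pos 0 L (by omega)]
        congr 2; push_cast; ring

end BP


theorem stmt_3 (ν : ℕ) (hν : 1 ≤ ν) (s : ℕ) (hs : s ≤ ν) (L : ℕ) (nn : Fin ν → ℕ) :
    (RatFunc.X : K) ^ expAG ν s nn *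
      ∏ i : Fin ν, qB (RatFunc.X : K)
        ((nn i : ℤ) + (L : ℤ) - 2 * (∑ l ∈ Finset.Icc 1 ((i : ℕ) + 1), (NN nn l : ℤ)) -
          alph ((i : ℕ) + 1) s) (nn i) =
    ∑ d ∈ Pset ν 0 (L : ℤ) ((ν : ℤ) - s) 0 nn, (RatFunc.X : K) ^ pwt 0 d := by
  rw [BP.sum_eq]
  exact BP.main ν s L hs nn

end
end

section
/- For all integers ν ≥ 1 and 0 ≤ s ≤ ν, the polynomials C^ν_{0,L}(s,b,q) satisfy: (i) C^ν_{0,L}(s,ν,q) = C^ν_{0,L−1}(s,ν−1,q) for L ≥ 1; (ii) for 0 ≤ b < ν and L ≥ 2, C^ν_{0,L}(s,b,q) = C^ν_{0,L−1}(s,b−1+δ_{b,0},q) + C^ν_{0,L−1}(s,b+1,q) + (q^{L−1}−1)·C^ν_{0,L−2}(s,b,q); (iii) C^ν_{0,0}(s,b,q) = δ_{s,b} for 0 ≤ b ≤ ν, where δ is the Kronecker delta. -/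
open scoped Classical

noncomputable section

/-- The path ends with a NE step. -/
def EndsNE {n : ℕ} (d : Fin n → Fin 3) : Prop :=
  ∃ h : 1 ≤ n, d ⟨n - 1, by omega⟩ = 0

/-- Append a step. -/
def app {n : ℕ} (d : Fin n → Fin 3) (a : Fin 3) : Fin (n + 1) → Fin 3 :=
  fun i => if h : (i : ℕ) < n then d ⟨i, h⟩ else a

theorem app_lt {n : ℕ} (d : Fin n → Fin 3) (a : Fin 3) (k : ℕ) (h : k < n) (h' : k < n + 1) :
    app d a ⟨k, h'⟩ = d ⟨k, h⟩ := by simp [app, h]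

theorem app_last {n : ℕ} (d : Fin n → Fin 3) (a : Fin 3) (h' : n < n + 1) :
    app d a ⟨n, h'⟩ = a := by simp [app]

theorem hts_app_le (s : ℤ) {n : ℕ} (d : Fin n → Fin 3) (a : Fin 3) (k : ℕ) (hk : k ≤ n) :
    hts s (app d a) k = hts s d k := by
  unfold hts
  congr 1
  apply Finset.sum_congr rfl
  intro i hi
  have h1 : i < n := lt_of_lt_of_le (Finset.mem_range.1 hi) hk
  have h2 : i < n + 1 := by omega
  rw [dif_pos h1, dif_pos h2, app_lt d a i h1]

theorem hts_app_last (s : ℤ) {n : ℕ} (d : Fin n → Fin 3) (a : Fin 3) :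
    hts s (app d a) (n + 1) = hts s d n + stepVal a := by
  rw [← hts_app_le s d a n le_rfl]
  unfold hts
  rw [Finset.sum_range_succ, dif_pos (Nat.lt_succ_self n), app_last, add_assoc]

theorem isPeak_app {n : ℕ} (d : Fin n → Fin 3) (a : Fin 3) (k : ℕ) :
    IsPeak (app d a) k ↔ IsPeak d k ∨ (k = n ∧ EndsNE d ∧ a = 1) := by
  constructor
  · rintro ⟨hk, h1, h2, h3⟩
    rcases Nat.lt_or_ge k n with h | h
    · left
      refine ⟨h, h1, ?_, ?_⟩
      · rw [app_lt d a (k - 1) (by omega)] at h2; exact h2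
      · rw [app_lt d a k h] at h3; exact h3
    · right
      obtain rfl : k = n := by omega
      rw [app_lt d a (k - 1) (by omega)] at h2
      rw [app_last] at h3
      exact ⟨rfl, ⟨h1, h2⟩, h3⟩
  · rintro (⟨hk, h1, h2, h3⟩ | ⟨rfl, ⟨h1, h2⟩, h3⟩)
    · refine ⟨by omega, h1, ?_, ?_⟩
      · rw [app_lt d a (k - 1) (by omega)]; exact h2
      · rw [app_lt d a k hk]; exact h3
    · refine ⟨by omega, h1, ?_, ?_⟩
      · rw [app_lt d a (k - 1) (by omega)]; exact h2
      · rw [app_last]; exact h3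

theorem endsNE_app {n : ℕ} (d : Fin n → Fin 3) (a : Fin 3) :
    EndsNE (app d a) ↔ a = 0 := by
  unfold EndsNE
  constructor
  · rintro ⟨_, h⟩
    exact (app_last d a (by omega)).symm.trans h
  · intro h
    exact ⟨by omega, (app_last d a (by omega)).trans h⟩

theorem IsPeak.lt_len {n : ℕ} {d : Fin n → Fin 3} {k : ℕ} (h : IsPeak d k) : k < n := h.1

theorem validPath_app (ν : ℕ) (s b : ℤ) {n : ℕ} (d : Fin n → Fin 3) (a : Fin 3) :
    ValidPath ν s b (app d a) ↔ ValidPath ν s (b - stepVal a) d ∧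
      (a = 1 → 0 < b - stepVal a) ∧ (a = 2 → b - stepVal a = 0) ∧
      (EndsNE d → a = 1 → b - stepVal a ≤ ν) := by
  unfold ValidPath
  rw [hts_app_last]
  constructor
  · rintro ⟨h1, h2, h3⟩
    have e : hts s d n = b - stepVal a := by omega
    refine ⟨⟨e, ?_, ?_⟩, ?_, ?_, ?_⟩
    · intro k
      have := h2 ⟨k, by omega⟩
      rwa [app_lt d a k k.2, hts_app_le _ _ _ _ (by simp)] at this
    · intro k hk
      have := h3 k ((isPeak_app d a k).2 (Or.inl hk))
      rwa [hts_app_le _ _ _ _ hk.lt_len.le] at this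
    · intro ha
      have := (h2 ⟨n, by omega⟩).1
      rw [app_last, hts_app_le _ _ _ _ le_rfl, e] at this
      exact this ha
    · intro ha
      have := (h2 ⟨n, by omega⟩).2
      rw [app_last, hts_app_le _ _ _ _ le_rfl, e] at this
      exact this ha
    · intro hE ha
      have := h3 n ((isPeak_app d a n).2 (Or.inr ⟨rfl, hE, ha⟩))
      rwa [hts_app_le _ _ _ _ le_rfl, e] at this
  · rintro ⟨⟨e, h2, h3⟩, h4, h5, h6⟩
    refine ⟨by omega, ?_, ?_⟩
    · rintro ⟨k, hk⟩
      rcases Nat.lt_or_ge k n with h | h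
      · rw [app_lt d a k h, hts_app_le _ _ _ _ h.le]
        exact h2 ⟨k, h⟩
      · obtain rfl : k = n := by omega
        rw [app_last, hts_app_le _ _ _ _ le_rfl, e]
        exact ⟨h4, h5⟩
    · intro k hk
      rcases (isPeak_app d a k).1 hk with h | ⟨rfl, hE, ha⟩
      · rw [hts_app_le _ _ _ _ h.lt_len.le]
        exact h3 k h
      · rw [hts_app_le _ _ _ _ le_rfl, e]
        exact h6 hE ha

theorem pwt_app {n : ℕ} (d : Fin n → Fin 3) (a : Fin 3) :
    pwt 0 (app d a) = pwt 0 d + if EndsNE d ∧ a = 1 then (n : ℤ) else 0 := by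
  unfold pwt
  have hn : ¬ IsPeak (app d a) (n + 1) := fun h => by have := h.lt_len; omega
  have hn' : ¬ IsPeak d n := fun h => by have := h.lt_len; omega
  rw [Finset.sum_range_succ, if_neg hn, Finset.sum_range_succ, Finset.sum_range_succ _ n,
    if_neg hn']
  have : ∑ k ∈ Finset.range n, (if IsPeak (app d a) k then (0 : ℤ) + (k : ℤ) else 0)
      = ∑ k ∈ Finset.range n, if IsPeak d k then (0 : ℤ) + (k : ℤ) else 0 := by
    apply Finset.sum_congr rfl
    intro k hk
    have hk := Finset.mem_range.1 hk
    have : IsPeak (app d a) k ↔ IsPeak d k := by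
      rw [isPeak_app]
      constructor
      · rintro (h | h)
        · exact h
        · omega
      · exact Or.inl
    simp only [this]
  rw [this]
  have h2 : IsPeak (app d a) n ↔ (EndsNE d ∧ a = 1) := by
    rw [isPeak_app]; simp [hn']
  simp only [h2]
  simp

/-- Paths of length `n + 1` are paths of length `n` with one step appended. -/
def appEquiv (n : ℕ) : (Fin 3 × (Fin n → Fin 3)) ≃ (Fin (n + 1) → Fin 3) where
  toFun p := app p.2 p.1
  invFun e := (e ⟨n, by omega⟩, fun i => e ⟨i, by omega⟩)
  left_inv p := by
    ext1
    · exact app_last _ _ _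
    · funext i; exact app_lt _ _ _ i.2 _
  right_inv e := by
    funext i
    rcases i with ⟨i, hi⟩
    rcases Nat.lt_or_ge i n with h | h
    · exact app_lt _ _ _ h _
    · obtain rfl : i = n := by omega
      exact app_last _ _ _

theorem exists_app {n : ℕ} (e : Fin (n + 1) → Fin 3) : ∃ d a, e = app d a :=
  ⟨((appEquiv n).symm e).2, ((appEquiv n).symm e).1, ((appEquiv n).apply_symm_apply e).symm⟩

theorem valid_nonneg (ν : ℕ) (s : ℤ) (hs : 0 ≤ s) {n : ℕ} :
    ∀ (b : ℤ) (d : Fin n → Fin 3), ValidPath ν s b d → 0 ≤ b := by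
  induction n with
  | zero =>
    intro b d h
    have := h.1
    simp [hts] at this
    omega
  | succ n ih =>
    intro b e h
    obtain ⟨d, a, rfl⟩ := exists_app e
    obtain ⟨h1, h2, h3, h4⟩ := (validPath_app ν s b d a).1 h
    have := ih _ d h1
    fin_cases a <;> simp [stepVal] at * <;> omega

theorem valid_high (ν : ℕ) (s : ℤ) (hs : s ≤ ν) {n : ℕ} :
    ∀ (b : ℤ) (d : Fin n → Fin 3), ValidPath ν s b d → (ν : ℤ) < b → EndsNE d := by
  induction n with
  | zero =>
    intro b d h
    have := h.1
    simp [hts] at this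
    omega
  | succ n ih =>
    intro b e h hb
    obtain ⟨d, a, rfl⟩ := exists_app e
    obtain ⟨h1, h2, h3, h4⟩ := (validPath_app ν s b d a).1 h
    have := ih _ d h1
    rw [endsNE_app]
    fin_cases a
    · rfl
    · exfalso
      simp [stepVal] at *
      have := h4 (this (by omega))
      omega
    · exfalso
      simp [stepVal] at *
      omega

/-- The path sum with prescribed number of steps, as a sum over all step sequences. -/
def SS {F : Type*} [Field F] (ν : ℕ) (s b : ℤ) (n : ℕ) (q : F) : F :=
  ∑ d : Fin n → Fin 3, if ValidPath ν s b d then q ^ pwt 0 d else 0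

/-- The part of `SS` of paths not ending in NE weighted normally and the other
ones with an additional factor `t`. -/
def SE {F : Type*} [Field F] (ν : ℕ) (s b : ℤ) (n : ℕ) (t q : F) : F :=
  ∑ d : Fin n → Fin 3, if ValidPath ν s b d then (if EndsNE d then t else 1) * q ^ pwt 0 d else 0

theorem Cpoly_eq {F : Type*} [Field F] (ν : ℕ) (L : ℤ) (n : ℕ) (h : L = n) (s b : ℕ) (q : F) :
    Cpoly ν 0 L s b q = SS ν s b n q := by
  subst h
  unfold Cpoly SS
  rw [Finset.sum_filter]
  have : ((n : ℤ) - 0).toNat = n := by omega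
  rw [this]

theorem sum_app {F : Type*} [Field F] (n : ℕ) (f : (Fin (n + 1) → Fin 3) → F) :
    ∑ e, f e = ∑ d : Fin n → Fin 3, f (app d 0) + ∑ d : Fin n → Fin 3, f (app d 1)
      + ∑ d : Fin n → Fin 3, f (app d 2) := by
  rw [← (appEquiv n).sum_comp, Fintype.sum_prod_type, Fin.sum_univ_three]
  rfl

theorem up_sum {F : Type*} [Field F] (ν : ℕ) (s b : ℤ) (n : ℕ) (q : F) :
    (∑ d : Fin n → Fin 3, if ValidPath ν s b (app d 0) then q ^ pwt 0 (app d 0) else 0)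
      = SS ν s (b - 1) n q := by
  unfold SS
  apply Finset.sum_congr rfl
  intro d _
  simp [validPath_app, pwt_app, stepVal]

theorem flat_sum {F : Type*} [Field F] (ν : ℕ) (s b : ℤ) (n : ℕ) (q : F) :
    (∑ d : Fin n → Fin 3, if ValidPath ν s b (app d 2) then q ^ pwt 0 (app d 2) else 0)
      = if b = 0 then SS ν s 0 n q else 0 := by
  split_ifs with hb
  · subst hb
    unfold SS
    apply Finset.sum_congr rfl
    intro d _
    simp [validPath_app, pwt_app, stepVal]
  · apply Finset.sum_eq_zero
    intro d _
    simp [validPath_app, stepVal, hb]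

theorem down_sum {F : Type*} [Field F] (ν : ℕ) (s b : ℤ) (hb : 0 ≤ b) (hb' : b < ν) (n : ℕ)
    (q : F) (hq : q ≠ 0) :
    (∑ d : Fin n → Fin 3, if ValidPath ν s b (app d 1) then q ^ pwt 0 (app d 1) else 0)
      = SE ν s (b + 1) n (q ^ n) q := by
  unfold SE
  apply Finset.sum_congr rfl
  intro d _
  have h1 : 0 < b + 1 := by omega
  have h2 : b + 1 ≤ (ν : ℤ) := by omega
  by_cases hE : EndsNE d
  · simp [validPath_app, pwt_app, stepVal, h1, h2, hE, zpow_add₀ hq, mul_comm]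
  · simp [validPath_app, pwt_app, stepVal, h1, hE]

theorem SE_succ {F : Type*} [Field F] (ν : ℕ) (s b : ℤ) (n : ℕ) (t q : F) :
    SE ν s b (n + 1) t q = SS ν s b (n + 1) q + (t - 1) * SS ν s (b - 1) n q := by
  rw [← up_sum]
  unfold SE SS
  rw [sum_app, sum_app]
  simp only [endsNE_app]
  simp only [Fin.isValue, if_true, one_ne_zero, if_false, one_mul,
    show (2 : Fin 3) ≠ 0 from by decide]
  have : ∀ d : Fin n → Fin 3,
      (if ValidPath ν s b (app d 0) then t * q ^ pwt 0 (app d 0) else 0)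
        = t * (if ValidPath ν s b (app d 0) then q ^ pwt 0 (app d 0) else 0) := by
    intro d; split_ifs <;> simp
  simp only [this, ← Finset.mul_sum]
  ring

theorem down_zero {F : Type*} [Field F] (ν : ℕ) (s : ℤ) (hs : s ≤ ν) (n : ℕ) (q : F) :
    (∑ d : Fin n → Fin 3, if ValidPath ν s ν (app d 1) then q ^ pwt 0 (app d 1) else 0) = 0 := by
  apply Finset.sum_eq_zero
  intro d _
  rw [if_neg]
  intro h
  obtain ⟨h1, h2, h3, h4⟩ := (validPath_app ν s ν d 1).1 h
  simp [stepVal] at *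
  have := h4 (valid_high ν s hs _ d h1 (by omega))
  omega

theorem SS_neg {F : Type*} [Field F] (ν : ℕ) (s : ℤ) (hs : 0 ≤ s) (b : ℤ) (hb : b < 0)
    (n : ℕ) (q : F) : SS ν s b n q = 0 := by
  apply Finset.sum_eq_zero
  intro d _
  rw [if_neg]
  intro h
  have := valid_nonneg ν s hs b d h
  omega

theorem SS_succ {F : Type*} [Field F] (ν : ℕ) (s b : ℤ) (n : ℕ) (q : F) :
    SS ν s b (n + 1) q = SS ν s (b - 1) n q
      + (∑ d : Fin n → Fin 3, if ValidPath ν s b (app d 1) then q ^ pwt 0 (app d 1) else 0)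
      + if b = 0 then SS ν s 0 n q else 0 := by
  rw [← up_sum, ← flat_sum, SS, sum_app]

theorem stmt_4 (ν : ℕ) (hν : 1 ≤ ν) (s : ℕ) (hs : s ≤ ν) :
    (∀ L : ℕ, 1 ≤ L →
      Cpoly ν 0 (L : ℤ) s ν (RatFunc.X : K) = Cpoly ν 0 ((L : ℤ) - 1) s (ν - 1) RatFunc.X) ∧
    (∀ L : ℕ, 2 ≤ L → ∀ b : ℕ, b < ν →
      Cpoly ν 0 (L : ℤ) s b (RatFunc.X : K) =
        Cpoly ν 0 ((L : ℤ) - 1) s (if b = 0 then 0 else b - 1) RatFunc.X +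
        Cpoly ν 0 ((L : ℤ) - 1) s (b + 1) RatFunc.X +
        ((RatFunc.X : K) ^ (L - 1) - 1) * Cpoly ν 0 ((L : ℤ) - 2) s b RatFunc.X) ∧
    (∀ b : ℕ, b ≤ ν →
      Cpoly ν 0 0 s b (RatFunc.X : K) = if s = b then 1 else 0) := by
  refine ⟨?_, ?_, ?_⟩
  · intro L hL
    obtain ⟨n, rfl⟩ : ∃ n, L = n + 1 := ⟨L - 1, by omega⟩
    rw [Cpoly_eq ν _ (n + 1) rfl, Cpoly_eq ν _ n (by push_cast; ring), SS_succ,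
      down_zero ν s (by exact_mod_cast hs), if_neg (by omega), Nat.cast_sub hν]
    simp
  · intro L hL b hb
    obtain ⟨n, rfl⟩ : ∃ n, L = n + 2 := ⟨L - 2, by omega⟩
    rw [Cpoly_eq ν _ (n + 1 + 1) rfl, Cpoly_eq ν _ (n + 1) (by push_cast; ring),
      Cpoly_eq ν _ (n + 1) (by push_cast; ring), Cpoly_eq ν _ n (by push_cast; ring), SS_succ,
      down_sum ν s b (by omega) (by exact_mod_cast hb) _ _ RatFunc.X_ne_zero, SE_succ]
    have e : n + 2 - 1 = n + 1 := rfl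
    rw [e, add_sub_cancel_right, Nat.cast_add, Nat.cast_one]
    by_cases h0 : b = 0
    · subst h0
      rw [SS_neg ν s (by omega) (((0 : ℕ) : ℤ) - 1) (by omega)]
      simp
      ring
    · rw [if_neg (by omega), if_neg h0, Nat.cast_sub (by omega)]
      simp
      ring
  · intro b _
    rw [Cpoly_eq ν 0 0 (by simp)]
    have hv : ∀ d : Fin 0 → Fin 3, ValidPath ν (s : ℤ) (b : ℤ) d ↔ s = b := by
      intro d
      unfold ValidPath
      constructor
      · rintro ⟨h, _⟩
        simp [hts] at h
        exact h
      · rintro rfl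
        exact ⟨by simp [hts], fun k => k.elim0, fun k hk => absurd hk.lt_len (by omega)⟩
    have hw : ∀ d : Fin 0 → Fin 3, pwt 0 d = 0 := by
      intro d
      unfold pwt
      simp
    unfold SS
    simp only [hv, hw]
    simp


end
end

section
/- For all integers ν ≥ 1, s, b, and L ≥ 2 with L ≡ s + b (mod 2), the following identity of polynomials in q holds: B^ν_{s,b}(L,q) = B^ν_{s,b−1}(L−1,q) + B^ν_{s,b+1}(L−1,q) + (q^{L−1}−1)·B^ν_{s,b}(L−2,q). -/
open scoped Classical

noncomputable section

theorem qP_succ {F : Type*} [Field F] (q : F) (n : ℕ) :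
    qP q (n + 1) = qP q n * (1 - q ^ (n + 1)) := by
  unfold qP
  rw [Finset.prod_range_succ]

theorem X_pow_ne (n : ℕ) : (1 : K) - RatFunc.X ^ (n + 1) ≠ 0 := by
  intro h
  have h1 : (RatFunc.X : K) ^ (n + 1) = 1 := (sub_eq_zero.mp h).symm
  have h2 : algebraMap (Polynomial ℚ) (RatFunc ℚ) (Polynomial.X ^ (n + 1))
      = algebraMap (Polynomial ℚ) (RatFunc ℚ) 1 := by
    rw [map_pow, RatFunc.algebraMap_X, map_one]
    exact h1
  have h3 := RatFunc.algebraMap_injective ℚ h2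
  have h4 := congrArg Polynomial.natDegree h3
  simp at h4

theorem qP_ne (n : ℕ) : qP (RatFunc.X : K) n ≠ 0 := by
  unfold qP
  exact Finset.prod_ne_zero_iff.mpr fun j _ => X_pow_ne j

theorem qP_zero {F : Type*} [Field F] (q : F) : qP q 0 = 1 := by
  simp [qP]

theorem qB_rec (n : ℕ) (k : ℤ) :
    qB (RatFunc.X : K) ((n + 2 : ℕ) : ℤ) k =
      qB RatFunc.X ((n + 1 : ℕ) : ℤ) (k - 1) + qB RatFunc.X ((n + 1 : ℕ) : ℤ) k +
        ((RatFunc.X : K) ^ (n + 1) - 1) * qB RatFunc.X (n : ℤ) (k - 1) := by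
  by_cases hk : 0 ≤ k ∧ k ≤ n + 2
  swap
  · unfold qB
    rw [if_neg (by omega), if_neg (by omega), if_neg (by omega),
      if_neg (by omega)]
    ring
  by_cases h0 : k = 0
  · subst h0
    unfold qB
    rw [if_pos (by omega), if_neg (by omega), if_pos (by omega),
      if_neg (by omega)]
    have e1 : ((0 : ℤ)).toNat = 0 := rfl
    have h1 := qP_ne (n + 1)
    have h2 := qP_ne (n + 2)
    simp only [sub_zero, e1, Int.toNat_natCast, qP_zero]
    rw [one_mul, one_mul, div_self h1, div_self h2]
    ring
  by_cases hn : k = n + 2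
  · subst hn
    unfold qB
    rw [if_pos (by omega), if_pos (by omega), if_neg (by omega),
      if_neg (by omega)]
    have e1 : ((n : ℤ) + 2).toNat = n + 2 := by omega
    have e2 : ((n : ℤ) + 2 - 1).toNat = n + 1 := by omega
    have e3 : (((n + 2 : ℕ) : ℤ) - ((n : ℤ) + 2)).toNat = 0 := by omega
    have e4 : (((n + 1 : ℕ) : ℤ) - ((n : ℤ) + 2 - 1)).toNat = 0 := by omega
    have h1 := qP_ne (n + 1)
    have h2 := qP_ne (n + 2)
    rw [e1, e2, e3, e4]
    simp only [Int.toNat_natCast, qP_zero]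
    rw [mul_one, mul_one, div_self h1, div_self h2]
    ring
  obtain ⟨a, rfl⟩ : ∃ a : ℕ, k = a + 1 := ⟨(k - 1).toNat, by omega⟩
  obtain ⟨c, rfl⟩ : ∃ c : ℕ, n = a + c := ⟨n - a, by omega⟩
  unfold qB
  rw [if_pos (by omega), if_pos (by omega), if_pos (by omega),
      if_pos (by omega)]
  have e1 : ((a : ℤ) + 1).toNat = a + 1 := by omega
  have e2 : ((a : ℤ) + 1 - 1).toNat = a := by omega
  have e3 : (((a + c + 2 : ℕ) : ℤ) - ((a : ℤ) + 1)).toNat = c + 1 := by omega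
  have e4 : (((a + c + 1 : ℕ) : ℤ) - ((a : ℤ) + 1 - 1)).toNat = c + 1 := by omega
  have e5 : (((a + c + 1 : ℕ) : ℤ) - ((a : ℤ) + 1)).toNat = c := by omega
  have e6 : (((a + c : ℕ) : ℤ) - ((a : ℤ) + 1 - 1)).toNat = c := by omega
  rw [e1, e2, e3, e4, e5, e6]
  simp only [Int.toNat_natCast]
  rw [qP_succ _ (a + c + 1), qP_succ _ (a + c), qP_succ _ a, qP_succ _ c]
  have h1 := qP_ne a
  have h2 := qP_ne c
  have h3 := X_pow_ne a
  have h4 := X_pow_ne c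
  field_simp
  ring

theorem qB_fin {F : Type*} [Field F] (q : F) (N A m : ℤ) (hm : m ≠ 0) (w : ℤ → F) :
    (Function.support fun j : ℤ => w j * qB q N (A + j * m)).Finite := by
  apply ((Set.finite_Icc (0 : ℤ) N).preimage (f := fun j : ℤ => A + j * m) ?_).subset
  · intro j hj
    by_contra h
    apply hj
    have h' : ¬ (0 ≤ A + j * m ∧ A + j * m ≤ N) := h
    simp only [qB, if_neg h', mul_zero]
  · intro x _ y _ hxy
    have h1 : A + x * m = A + y * m := hxy
    exact mul_right_cancel₀ hm (add_left_cancel h1)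

theorem B_fin {F : Type*} [Field F] (q : F) (N A A' m : ℤ) (hm : m ≠ 0) (w w' : ℤ → F) :
    (Function.support fun j : ℤ => w j * qB q N (A + j * m) - w' j * qB q N (A' + j * m)).Finite :=
  ((qB_fin q N A m hm w).union (qB_fin q N A' m hm w')).subset (Function.support_sub _ _)

theorem stmt_5 (ν : ℕ) (hν : 1 ≤ ν) (s b : ℤ) (L : ℕ) (hL : 2 ≤ L)
    (hpar : (L : ℤ) ≡ s + b [ZMOD 2]) :
    B ν s b L (RatFunc.X : K) =
      B ν s (b - 1) (L - 1) RatFunc.X + B ν s (b + 1) (L - 1) RatFunc.X +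
        ((RatFunc.X : K) ^ (L - 1) - 1) * B ν s b (L - 2) RatFunc.X := by
  obtain ⟨n, rfl⟩ : ∃ n, L = n + 2 := ⟨L - 2, by omega⟩
  have hm : (2 * (ν : ℤ) + 3) ≠ 0 := by omega
  rw [show n + 2 - 1 = n + 1 from rfl, show n + 2 - 2 = n from rfl]
  unfold B
  rw [mul_finsum' _ _ (B_fin _ _ _ _ _ hm _ _),
    ← finsum_add_distrib (B_fin _ _ _ _ _ hm _ _) (B_fin _ _ _ _ _ hm _ _),
    ← finsum_add_distrib]
  · apply finsum_congr
    intro j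
    rw [qB_rec, qB_rec]
    have e (t : ℤ) : (((n + 1 : ℕ) : ℤ) + (b - 1) + t) / 2 + j * (2 * (ν : ℤ) + 3)
        = (((n + 2 : ℕ) : ℤ) + b + t) / 2 + j * (2 * (ν : ℤ) + 3) - 1 := by push_cast; omega
    have f (t : ℤ) : (((n + 1 : ℕ) : ℤ) + (b + 1) + t) / 2 + j * (2 * (ν : ℤ) + 3)
        = (((n + 2 : ℕ) : ℤ) + b + t) / 2 + j * (2 * (ν : ℤ) + 3) := by push_cast; omega
    have g (t : ℤ) : ((n : ℤ) + b + t) / 2 + j * (2 * (ν : ℤ) + 3)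
        = (((n + 2 : ℕ) : ℤ) + b + t) / 2 + j * (2 * (ν : ℤ) + 3) - 1 := by push_cast; omega
    have e' := e (-s)
    have f' := f (-s)
    have g' := g (-s)
    simp only [← sub_eq_add_neg] at e' f' g'
    rw [e s, f s, g s, e', f', g']
    ring
  · exact ((B_fin _ _ _ _ _ hm _ _).union (B_fin _ _ _ _ _ hm _ _)).subset
      (Function.support_add _ _)
  · refine (B_fin _ _ _ _ _ hm _ _).subset (Function.support_mul_subset_right _ _)

end
end
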